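/- arXiv:math/0211224 — 5 statements merged into one kernel-verified Lean document; each statement's English description precedes it below -/
import Mathlib

section
/- Let l and m be negative rational numbers, and let Q be the quadratic form on ℚ⁶ given by Q(x) = 2x₁x₂ + 2x₃x₄ + l·x₅² + m·x₆² (the orthogonal sum Hyp ⊕ Hyp ⊕ ⟨l⟩ ⊕ ⟨m⟩ of two hyperbolic planes and two rank-one forms). Then the even Clifford algebra C⁺(Q) is isomorphic, as a ℚ-algebra, to the algebra of 4×4 matrices over the field K = ℚ[X]/(X² + l·m) (the imaginary quadratic field ℚ(√(−lm)), which is a field since −lm < 0). -/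
open Polynomial

section Dimension

variable {F V : Type*} [Field F] [AddCommGroup V] [Module F V]

lemma CliffordAlgebra.finite_of_finite [Invertible (2 : F)] [Module.Finite F V]
    (Q : QuadraticForm F V) : Module.Finite F (CliffordAlgebra Q) :=
  Module.Finite.of_basis
    ((Module.finBasis F V).ExteriorAlgebra.map (CliffordAlgebra.equivExterior Q).symm)

lemma CliffordAlgebra.finrank_eq_two_pow [Invertible (2 : F)] [Module.Finite F V]
    (Q : QuadraticForm F V) :
    Module.finrank F (CliffordAlgebra Q) = 2 ^ Module.finrank F V := by
  rw [Module.finrank_eq_card_basis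
    ((Module.finBasis F V).ExteriorAlgebra.map (CliffordAlgebra.equivExterior Q).symm)]
  simp

/-- If `Q` represents a nonzero scalar, the even Clifford algebra has at most half the dimension
of the full Clifford algebra. -/
lemma CliffordAlgebra.two_mul_finrank_even_le [Invertible (2 : F)] [Module.Finite F V]
    (Q : QuadraticForm F V) {v : V} (hv : Q v ≠ 0) :
    2 * Module.finrank F (CliffordAlgebra.even Q) ≤ 2 ^ Module.finrank F V := by
  have := CliffordAlgebra.finite_of_finite Q
  have hcompl := Submodule.finrank_add_eq_of_isCompl (CliffordAlgebra.evenOdd_isCompl Q)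
  rw [CliffordAlgebra.finrank_eq_two_pow] at hcompl
  have hmem : ∀ x ∈ CliffordAlgebra.evenOdd Q 0,
      LinearMap.mulLeft F (CliffordAlgebra.ι Q v) x ∈ CliffordAlgebra.evenOdd Q 1 := fun x hx => by
    simpa using SetLike.mul_mem_graded (CliffordAlgebra.ι_mem_evenOdd_one Q v) hx
  have hinj : Function.Injective
      ((LinearMap.mulLeft F (CliffordAlgebra.ι Q v)).restrict hmem) := by
    intro x y hxy
    have h : CliffordAlgebra.ι Q v * x = CliffordAlgebra.ι Q v * y := congrArg Subtype.val hxy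
    have h' := congrArg (CliffordAlgebra.ι Q v * ·) h
    simp only [← mul_assoc, CliffordAlgebra.ι_sq_scalar, ← Algebra.smul_def] at h'
    exact Subtype.ext (smul_right_injective _ hv h')
  have hle := LinearMap.finrank_le_finrank_of_injective hinj
  have heven : Module.finrank F (CliffordAlgebra.even Q)
      = Module.finrank F (CliffordAlgebra.evenOdd Q 0) := rfl
  omega

end Dimension

section Skew

variable {K : Type*} [CommRing K]

/-- The alternating `4 × 4` matrix with the given entries above the diagonal. -/
def skewMatrix (a b c d e f : K) : Matrix (Fin 4) (Fin 4) K :=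
  !![0, a, b, c; -a, 0, d, e; -b, -d, 0, f; -c, -e, -f, 0]

/-- An alternating `4 × 4` matrix times its Pfaffian adjoint is its Pfaffian. -/
lemma skewMatrix_mul_dual (a b c d e f : K) :
    skewMatrix a b c d e f * skewMatrix (-f) e (-d) (-c) b (-a)
      = (a * f - b * e + c * d) • (1 : Matrix (Fin 4) (Fin 4) K) := by
  ext i j
  fin_cases i <;> fin_cases j <;>
    simp [skewMatrix, Matrix.mul_apply, Fin.sum_univ_four] <;> ring

lemma skewMatrix_dual_mul (a b c d e f : K) :
    skewMatrix (-f) e (-d) (-c) b (-a) * skewMatrix a b c d e f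
      = (a * f - b * e + c * d) • (1 : Matrix (Fin 4) (Fin 4) K) := by
  have h := skewMatrix_mul_dual (-f) e (-d) (-c) b (-a)
  simp only [neg_neg] at h
  rw [h]
  congr 1
  ring

end Skew

section HalfSpin

variable {K : Type*} [CommRing K] [Algebra ℚ K]

/-- The half-spin map from vectors to alternating matrices, whose Pfaffian is the quadratic form
`2x₀x₁ + 2x₂x₃ + lx₄² + mx₅²` when `s² = -lm`. -/
def halfSpin (l : ℚ) (s : K) : (Fin 6 → ℚ) →ₗ[ℚ] Matrix (Fin 4) (Fin 4) K where
  toFun x := skewMatrix (algebraMap ℚ K (2 * x 0)) (algebraMap ℚ K (-(2 * x 2)))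
    (algebraMap ℚ K (l * x 4) - algebraMap ℚ K (x 5) * s)
    (algebraMap ℚ K (x 4) + algebraMap ℚ K (l⁻¹ * x 5) * s)
    (algebraMap ℚ K (x 3)) (algebraMap ℚ K (x 1))
  map_add' x y := by
    ext i j
    fin_cases i <;> fin_cases j <;> simp [skewMatrix] <;> ring
  map_smul' c x := by
    ext i j
    fin_cases i <;> fin_cases j <;> simp [skewMatrix, Algebra.smul_def] <;> ring

/-- The Pfaffian adjoint of `halfSpin`. -/
def halfSpinDual (l : ℚ) (s : K) : (Fin 6 → ℚ) →ₗ[ℚ] Matrix (Fin 4) (Fin 4) K where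
  toFun x := skewMatrix (-(algebraMap ℚ K (x 1))) (algebraMap ℚ K (x 3))
    (-(algebraMap ℚ K (x 4) + algebraMap ℚ K (l⁻¹ * x 5) * s))
    (-(algebraMap ℚ K (l * x 4) - algebraMap ℚ K (x 5) * s))
    (algebraMap ℚ K (-(2 * x 2))) (-(algebraMap ℚ K (2 * x 0)))
  map_add' x y := by
    ext i j
    fin_cases i <;> fin_cases j <;> simp [skewMatrix] <;> ring
  map_smul' c x := by
    ext i j
    fin_cases i <;> fin_cases j <;> simp [skewMatrix, Algebra.smul_def] <;> ring

variable {l m : ℚ} {s : K}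

lemma halfSpin_pfaffian (hl : l ≠ 0) (hs : s ^ 2 = algebraMap ℚ K (-(l * m))) (x : Fin 6 → ℚ) :
    algebraMap ℚ K (2 * x 0) * algebraMap ℚ K (x 1)
      - algebraMap ℚ K (-(2 * x 2)) * algebraMap ℚ K (x 3)
      + (algebraMap ℚ K (l * x 4) - algebraMap ℚ K (x 5) * s)
        * (algebraMap ℚ K (x 4) + algebraMap ℚ K (l⁻¹ * x 5) * s)
      = algebraMap ℚ K (2 * x 0 * x 1 + 2 * x 2 * x 3 + l * x 4 ^ 2 + m * x 5 ^ 2) := by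
  have h : algebraMap ℚ K l * algebraMap ℚ K l⁻¹ = 1 := by
    rw [← map_mul, mul_inv_cancel₀ hl, map_one]
  simp only [map_mul, map_neg, map_add, map_pow] at hs ⊢
  linear_combination (algebraMap ℚ K (x 4) * algebraMap ℚ K (x 5) * s
    + algebraMap ℚ K m * algebraMap ℚ K (x 5) ^ 2) * h
    - algebraMap ℚ K l⁻¹ * algebraMap ℚ K (x 5) ^ 2 * hs

/-- The half-spin representation on pairs of vectors. -/
def halfSpinEvenHom (hl : l ≠ 0) (hs : s ^ 2 = algebraMap ℚ K (-(l * m)))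
    (Q : QuadraticForm ℚ (Fin 6 → ℚ))
    (hQ : ∀ x : Fin 6 → ℚ,
      Q x = 2 * x 0 * x 1 + 2 * x 2 * x 3 + l * x 4 ^ 2 + m * x 5 ^ 2) :
    CliffordAlgebra.EvenHom Q (Matrix (Fin 4) (Fin 4) K) where
  bilin := (LinearMap.mul ℚ (Matrix (Fin 4) (Fin 4) K)).compl₁₂ (halfSpin l s) (halfSpinDual l s)
  contract x := by
    refine (skewMatrix_mul_dual _ _ _ _ _ _).trans ?_
    rw [halfSpin_pfaffian hl hs, ← hQ, algebraMap_smul, Algebra.algebraMap_eq_smul_one]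
  contract_mid x y z := by
    have h : halfSpinDual l s y * halfSpin l s y = Q y • 1 := by
      refine (skewMatrix_dual_mul _ _ _ _ _ _).trans ?_
      rw [halfSpin_pfaffian hl hs, ← hQ, algebraMap_smul]
    simp only [LinearMap.compl₁₂_apply, LinearMap.mul_apply']
    rw [mul_assoc, ← mul_assoc (halfSpinDual l s y), h, smul_mul_assoc, one_mul, mul_smul_comm]

lemma halfSpin_mul_mem_range (hl : l ≠ 0) (hs : s ^ 2 = algebraMap ℚ K (-(l * m)))
    (Q : QuadraticForm ℚ (Fin 6 → ℚ))
    (hQ : ∀ x : Fin 6 → ℚ,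
      Q x = 2 * x 0 * x 1 + 2 * x 2 * x 3 + l * x 4 ^ 2 + m * x 5 ^ 2) (x y : Fin 6 → ℚ) :
    halfSpin l s x * halfSpinDual l s y
      ∈ (CliffordAlgebra.even.lift Q (halfSpinEvenHom hl hs Q hQ)).range :=
  ⟨(CliffordAlgebra.even.ι Q).bilin x y, CliffordAlgebra.even.lift_ι Q _ x y⟩

lemma Matrix.single_mem_of_diag_mem {n : Type*} [Fintype n] [DecidableEq n]
    {S : Subalgebra ℚ (Matrix n n K)} (hS : ∀ i, Matrix.single i i (1 : K) ∈ S)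
    {A : Matrix n n K} (hA : A ∈ S) (i j : n) : Matrix.single i j (A i j) ∈ S := by
  have h := S.mul_mem (S.mul_mem (hS i) hA) (hS j)
  rwa [Matrix.single_mul_mul_single, one_mul, mul_one] at h

lemma Subalgebra.eq_top_of_single_mem {n : Type*} [Fintype n] [DecidableEq n]
    {S : Subalgebra ℚ (Matrix n n K)}
    (hK : ∀ c : K, ∃ a b : ℚ, c = algebraMap ℚ K a + algebraMap ℚ K b * s)
    (hdiag : ∀ i, Matrix.single i i (1 : K) ∈ S) (hs : ∀ i, Matrix.single i i s ∈ S)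
    (hunit : ∀ i j, ∃ A ∈ S, ∃ q : ℚ, q ≠ 0 ∧ A i j = algebraMap ℚ K q) : S = ⊤ := by
  have hone : ∀ i j, Matrix.single i j (1 : K) ∈ S := by
    intro i j
    obtain ⟨A, hA, q, hq, h⟩ := hunit i j
    have := S.smul_mem (Matrix.single_mem_of_diag_mem hdiag hA i j) q⁻¹
    rwa [h, Matrix.smul_single, Algebra.smul_def, ← map_mul, inv_mul_cancel₀ hq, map_one] at this
  rw [eq_top_iff]
  intro A _
  rw [Matrix.matrix_eq_sum_single A]
  refine S.sum_mem fun i _ => S.sum_mem fun j _ => ?_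
  obtain ⟨a, b, h⟩ := hK (A i j)
  have h₁ := S.smul_mem (hone i j) a
  have h₂ := S.smul_mem (S.mul_mem (hs i) (hone i j)) b
  have := S.add_mem h₁ h₂
  rwa [Matrix.single_mul_single_same, mul_one, Matrix.smul_single, Matrix.smul_single,
    ← Matrix.single_add, Algebra.smul_def, Algebra.smul_def, mul_one, ← h] at this

lemma single_diag_mem_of_halfSpin_mul_mem {S : Subalgebra ℚ (Matrix (Fin 4) (Fin 4) K)}
    (hS : ∀ x y, halfSpin l s x * halfSpinDual l s y ∈ S) (i : Fin 4) :
    Matrix.single i i (1 : K) ∈ S := by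
  have hP : Matrix.diagonal ![1, 1, 0, 0] ∈ S := by
    convert S.smul_mem (hS (Pi.single 0 1) (Pi.single 1 1)) (1 / 2) using 1
    ext i j
    fin_cases i <;> fin_cases j <;>
      simp [halfSpin, halfSpinDual, skewMatrix, Algebra.smul_def, ← map_mul]
  have hR : Matrix.diagonal ![1, 0, 1, 0] ∈ S := by
    convert S.smul_mem (hS (Pi.single 2 1) (Pi.single 3 1)) (1 / 2) using 1
    ext i j
    fin_cases i <;> fin_cases j <;>
      simp [halfSpin, halfSpinDual, skewMatrix, Algebra.smul_def, ← map_mul]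
  have hPR := S.mul_mem hP hR
  rw [Matrix.diagonal_mul_diagonal] at hPR
  have hsingle : Matrix.single i i (1 : K) = Matrix.diagonal (Pi.single i 1) :=
    (Matrix.diagonal_single i 1).symm
  rw [hsingle]
  fin_cases i
  · convert hPR using 2
    ext j
    fin_cases j <;> simp
  · convert S.sub_mem hP hPR using 1
    rw [Matrix.diagonal_sub]
    congr 1
    ext j
    fin_cases j <;> simp
  · convert S.sub_mem hR hPR using 1
    rw [Matrix.diagonal_sub]
    congr 1
    ext j
    fin_cases j <;> simp
  · convert S.add_mem (S.sub_mem (S.sub_mem S.one_mem hP) hR) hPR using 1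
    rw [← Matrix.diagonal_one, Matrix.diagonal_sub, Matrix.diagonal_sub, Matrix.diagonal_add]
    congr 1
    ext j
    fin_cases j <;> simp

lemma single_root_mem_of_halfSpin_mul_mem (hl : l ≠ 0)
    {S : Subalgebra ℚ (Matrix (Fin 4) (Fin 4) K)}
    (hS : ∀ x y, halfSpin l s x * halfSpinDual l s y ∈ S) (i : Fin 4) :
    Matrix.single i i s ∈ S := by
  have hinv : algebraMap ℚ K l * algebraMap ℚ K l⁻¹ = 1 := by
    rw [← map_mul, mul_inv_cancel₀ hl, map_one]
  have hneg : ∀ i, Matrix.single i i (-s) ∈ S → Matrix.single i i s ∈ S := fun i h => by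
    simpa [← Matrix.single_neg] using S.neg_mem h
  have h := Matrix.single_mem_of_diag_mem (single_diag_mem_of_halfSpin_mul_mem hS)
      (hS (Pi.single 4 1) (Pi.single 5 1)) i i
  fin_cases i
  · convert h using 2
    simp [halfSpin, halfSpinDual, skewMatrix, Matrix.mul_apply, Fin.sum_univ_four]
    linear_combination -s * hinv
  · apply hneg
    convert h using 2
    simp [halfSpin, halfSpinDual, skewMatrix, Matrix.mul_apply, Fin.sum_univ_four]
  · apply hneg
    convert h using 2
    simp [halfSpin, halfSpinDual, skewMatrix, Matrix.mul_apply, Fin.sum_univ_four]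
  · convert h using 2
    simp [halfSpin, halfSpinDual, skewMatrix, Matrix.mul_apply, Fin.sum_univ_four]
    linear_combination -s * hinv

lemma exists_mem_apply_eq_of_halfSpin_mul_mem (hl : l ≠ 0)
    {S : Subalgebra ℚ (Matrix (Fin 4) (Fin 4) K)}
    (hS : ∀ x y, halfSpin l s x * halfSpinDual l s y ∈ S) (i j : Fin 4) :
    ∃ A ∈ S, ∃ q : ℚ, q ≠ 0 ∧ A i j = algebraMap ℚ K q := by
  have key : ∀ (i j : Fin 4) (a b : Fin 6) (q : ℚ), q ≠ 0 →
      (halfSpin l s (Pi.single a 1) * halfSpinDual l s (Pi.single b 1)) i j = algebraMap ℚ K q →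
      ∃ A ∈ S, ∃ q : ℚ, q ≠ 0 ∧ A i j = algebraMap ℚ K q :=
    fun i j a b q hq h => ⟨_, hS _ _, q, hq, h⟩
  have hunit : ∀ i : Fin 4, ∃ A ∈ S, ∃ q : ℚ, q ≠ 0 ∧ A i i = algebraMap ℚ K q :=
    fun i => ⟨1, S.one_mem, 1, one_ne_zero, by simp⟩
  fin_cases i <;> fin_cases j
  · exact hunit 0
  · refine key 0 1 2 4 (-2 * l) (by simpa) ?_
    simp [halfSpin, halfSpinDual, skewMatrix, Matrix.mul_apply, Fin.sum_univ_four]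
  · refine key 0 2 0 4 (-2 * l) (by simpa) ?_
    simp [halfSpin, halfSpinDual, skewMatrix, Matrix.mul_apply, Fin.sum_univ_four]
  · refine key 0 3 0 2 (-(2 * 2)) (by norm_num) ?_
    simp [halfSpin, halfSpinDual, skewMatrix, Matrix.mul_apply, Fin.sum_univ_four]
  · refine key 1 0 4 3 (-1) (by norm_num) ?_
    simp [halfSpin, halfSpinDual, skewMatrix, Matrix.mul_apply, Fin.sum_univ_four]
  · exact hunit 1
  · refine key 1 2 0 3 (-2) (by norm_num) ?_
    simp [halfSpin, halfSpinDual, skewMatrix, Matrix.mul_apply, Fin.sum_univ_four]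
  · refine key 1 3 0 4 2 (by norm_num) ?_
    simp [halfSpin, halfSpinDual, skewMatrix, Matrix.mul_apply, Fin.sum_univ_four]
  · refine key 2 0 4 1 (-1) (by norm_num) ?_
    simp [halfSpin, halfSpinDual, skewMatrix, Matrix.mul_apply, Fin.sum_univ_four]
  · refine key 2 1 2 1 (-2) (by norm_num) ?_
    simp [halfSpin, halfSpinDual, skewMatrix, Matrix.mul_apply, Fin.sum_univ_four]
  · exact hunit 2
  · refine key 2 3 2 4 (-2) (by norm_num) ?_
    simp [halfSpin, halfSpinDual, skewMatrix, Matrix.mul_apply, Fin.sum_univ_four]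
  · refine key 3 0 1 3 1 (by norm_num) ?_
    simp [halfSpin, halfSpinDual, skewMatrix, Matrix.mul_apply, Fin.sum_univ_four]
  · refine key 3 1 4 1 l hl ?_
    simp [halfSpin, halfSpinDual, skewMatrix, Matrix.mul_apply, Fin.sum_univ_four]
  · refine key 3 2 4 3 (-l) (by simpa) ?_
    simp [halfSpin, halfSpinDual, skewMatrix, Matrix.mul_apply, Fin.sum_univ_four]
  · exact hunit 3

lemma halfSpin_range_eq_top (hl : l ≠ 0)
    {S : Subalgebra ℚ (Matrix (Fin 4) (Fin 4) K)}
    (hK : ∀ c : K, ∃ a b : ℚ, c = algebraMap ℚ K a + algebraMap ℚ K b * s)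
    (hS : ∀ x y, halfSpin l s x * halfSpinDual l s y ∈ S) : S = ⊤ :=
  Subalgebra.eq_top_of_single_mem hK (single_diag_mem_of_halfSpin_mul_mem hS)
    (single_root_mem_of_halfSpin_mul_mem hl hS) (exists_mem_apply_eq_of_halfSpin_mul_mem hl hS)

end HalfSpin

section Quadratic

lemma monic_X_sq_add_C (c : ℚ) : ((X : ℚ[X]) ^ 2 + C c).Monic :=
  monic_X_pow_add_C c two_ne_zero

lemma AdjoinRoot.finrank_X_sq_add_C (c : ℚ) :
    Module.finrank ℚ (AdjoinRoot ((X : ℚ[X]) ^ 2 + C c)) = 2 := by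
  rw [(AdjoinRoot.powerBasis' (monic_X_sq_add_C c)).finrank, AdjoinRoot.powerBasis'_dim,
    natDegree_X_pow_add_C]

lemma AdjoinRoot.root_sq_X_sq_add_C (c : ℚ) :
    AdjoinRoot.root ((X : ℚ[X]) ^ 2 + C c) ^ 2 = algebraMap ℚ _ (-c) := by
  have h := AdjoinRoot.eval₂_root ((X : ℚ[X]) ^ 2 + C c)
  simp only [eval₂_add, eval₂_pow, eval₂_X, eval₂_C] at h
  rw [AdjoinRoot.algebraMap_eq, map_neg]
  exact eq_neg_of_add_eq_zero_left h

lemma AdjoinRoot.exists_eq_add_mul_root (c : ℚ) (z : AdjoinRoot ((X : ℚ[X]) ^ 2 + C c)) :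
    ∃ a b : ℚ, z = algebraMap ℚ _ a + algebraMap ℚ _ b * AdjoinRoot.root _ := by
  let B := AdjoinRoot.powerBasis' (monic_X_sq_add_C c)
  have hd : B.dim = 2 := by
    rw [AdjoinRoot.powerBasis'_dim, natDegree_X_pow_add_C]
  let b := B.basis.reindex (finCongr hd)
  refine ⟨b.repr z 0, b.repr z 1, ?_⟩
  conv_lhs => rw [← b.sum_repr z]
  simp [b, B, Fin.sum_univ_two, Algebra.smul_def]

end Quadratic

/-- For negative rationals `l, m` and the quadratic form
`Q = Hyp ⊕ Hyp ⊕ ⟨l⟩ ⊕ ⟨m⟩` on `ℚ⁶`, the even Clifford algebra `C⁺(Q)` is isomorphic as a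
`ℚ`-algebra to the `4 × 4` matrix algebra over `K = ℚ[X]/(X² + l·m) = ℚ(√(-l·m))`. -/
theorem even_clifford_iso_matrix_quadratic_field
    (l m : ℚ) (hl : l < 0) (hm : m < 0)
    (Q : QuadraticForm ℚ (Fin 6 → ℚ))
    (hQ : ∀ x : Fin 6 → ℚ,
      Q x = 2 * x 0 * x 1 + 2 * x 2 * x 3 + l * x 4 ^ 2 + m * x 5 ^ 2) :
    Nonempty ((CliffordAlgebra.even Q) ≃ₐ[ℚ]
      Matrix (Fin 4) (Fin 4) (AdjoinRoot ((X : ℚ[X]) ^ 2 + C (l * m)))) := by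
  have hs := AdjoinRoot.root_sq_X_sq_add_C (l * m)
  let f := CliffordAlgebra.even.lift Q (halfSpinEvenHom hl.ne hs Q hQ)
  have hsurj : Function.Surjective f := AlgHom.range_eq_top f |>.mp <|
    halfSpin_range_eq_top hl.ne (AdjoinRoot.exists_eq_add_mul_root (l * m))
      (halfSpin_mul_mem_range hl.ne hs Q hQ)
  have : Invertible (2 : ℚ) := invertibleOfNonzero two_ne_zero
  have := CliffordAlgebra.finite_of_finite Q
  have hfin : Module.Finite ℚ (CliffordAlgebra.even Q) :=
    inferInstanceAs (Module.Finite ℚ (Subalgebra.toSubmodule (CliffordAlgebra.even Q)))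
  have := (monic_X_sq_add_C (l * m)).finite_adjoinRoot
  have hQe : Q (Pi.single 4 1) ≠ 0 := by simp [hQ, hl.ne]
  have hle := CliffordAlgebra.two_mul_finrank_even_le Q hQe
  have hge := LinearMap.finrank_le_finrank_of_surjective (f := f.toLinearMap) hsurj
  have hmat : Module.finrank ℚ
      (Matrix (Fin 4) (Fin 4) (AdjoinRoot ((X : ℚ[X]) ^ 2 + C (l * m)))) = 32 := by
    rw [Module.finrank_matrix, AdjoinRoot.finrank_X_sq_add_C]
    simp
  have heq : Module.finrank ℚ (CliffordAlgebra.even Q) = Module.finrank ℚ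
      (Matrix (Fin 4) (Fin 4) (AdjoinRoot ((X : ℚ[X]) ^ 2 + C (l * m)))) := by
    rw [Module.finrank_fin_fun] at hle
    omega
  have hinj : Function.Injective f :=
    (LinearMap.injective_iff_surjective_of_finrank_eq_finrank (f := f.toLinearMap) heq).mpr hsurj
  exact ⟨AlgEquiv.ofBijective f ⟨hinj, hsurj⟩⟩
end

section
/- Let d > 0 be a rational number and K = ℚ(φ) an imaginary quadratic field, i.e., a field extension of ℚ of degree 2 generated by an element φ with φ² = −d. Let V be a finite-dimensional K-vector space, regarded also as a ℚ-vector space by restriction of scalars, and let φ₂ : ⋀²_ℚ V → ⋀²_ℚ V be the ℚ-linear endomorphism of the second exterior power over ℚ induced by multiplication by φ, i.e., φ₂(v ∧ w) = (φv) ∧ (φw). Then the ℚ-linear map i : ⋀²_K V → ⋀²_ℚ V determined by i(a ∧_K b) = (1/2)·a ∧ b − (1/(2d))·(φa) ∧ (φb) is well defined and injective, and its range equals the (−d)-eigenspace of φ₂, that is, Im(i) = { w ∈ ⋀²_ℚ V : φ₂(w) = −d·w }. -/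
open ExteriorAlgebra

/-- The wedge `a ∧ b` of two vectors, as an element of the second exterior power
`⋀[R]^2 M ⊆ ExteriorAlgebra R M`. -/
noncomputable def wedge (R : Type*) {M : Type*} [CommRing R] [AddCommGroup M] [Module R M]
    (a b : M) : ⋀[R]^2 M :=
  ⟨ι R a * ι R b, by
    have : LinearMap.range (ι R : M →ₗ[R] ExteriorAlgebra R M) ^ 2 =
        LinearMap.range (ι R : M →ₗ[R] ExteriorAlgebra R M) *
          LinearMap.range (ι R : M →ₗ[R] ExteriorAlgebra R M) := pow_two _
    rw [exteriorPower, this]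
    exact Submodule.mul_mem_mul (LinearMap.mem_range_self _ a) (LinearMap.mem_range_self _ b)⟩

section Wedge

variable {R M : Type*} [CommRing R] [AddCommGroup M] [Module R M]

theorem wedge_eq_ιMulti (a b : M) : wedge R a b = exteriorPower.ιMulti R 2 ![a, b] := by
  apply Subtype.ext
  simp [wedge, ExteriorAlgebra.ιMulti_apply]

theorem wedge_add_left (a a' b : M) : wedge R (a + a') b = wedge R a b + wedge R a' b := by
  apply Subtype.ext
  simp [wedge, add_mul]

theorem wedge_add_right (a b b' : M) : wedge R a (b + b') = wedge R a b + wedge R a b' := by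
  apply Subtype.ext
  simp [wedge, mul_add]

theorem wedge_smul_left (r : R) (a b : M) : wedge R (r • a) b = r • wedge R a b := by
  apply Subtype.ext
  simp [wedge]

theorem wedge_smul_right (r : R) (a b : M) : wedge R a (r • b) = r • wedge R a b := by
  apply Subtype.ext
  simp [wedge]

theorem wedge_self (a : M) : wedge R a a = 0 := by
  apply Subtype.ext
  simp [wedge]

theorem wedge_swap (a b : M) : wedge R b a = -wedge R a b := by
  have h := wedge_self (R := R) (a + b)
  rw [wedge_add_left, wedge_add_right, wedge_add_right, wedge_self, wedge_self] at h
  rw [eq_neg_iff_add_eq_zero]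
  simpa [add_comm] using h

/-- Every element of the second exterior power is a sum of wedges of two vectors. -/
theorem wedge_induction {P : ⋀[R]^2 M → Prop} (w : ⋀[R]^2 M) (zero : P 0)
    (mem : ∀ a b, P (wedge R a b)) (add : ∀ x y, P x → P y → P (x + y)) : P w := by
  have hw : w ∈ Submodule.span R (Set.range (exteriorPower.ιMulti R 2 (M := M))) := by
    rw [exteriorPower.ιMulti_span]
    trivial
  suffices h : ∀ r : R, P (r • w) by simpa using h 1
  induction hw using Submodule.span_induction with
  | mem x hx =>
    obtain ⟨v, rfl⟩ := hx
    intro r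
    have hv : v = ![v 0, v 1] := by ext i; fin_cases i <;> rfl
    rw [hv, ← wedge_eq_ιMulti, ← wedge_smul_left]
    exact mem _ _
  | zero => simpa using zero
  | add x y _ _ hx hy =>
    intro r
    rw [smul_add]
    exact add _ _ (hx r) (hy r)
  | smul s x _ hx =>
    intro r
    rw [smul_smul]
    exact hx _

/-- An alternating bilinear map factors through the second exterior power. -/
theorem exists_linearMap_wedge {N : Type*} [AddCommGroup N] [Module R N]
    (B : M →ₗ[R] M →ₗ[R] N) (hB : ∀ a, B a a = 0) :
    ∃ f : ⋀[R]^2 M →ₗ[R] N, ∀ a b, f (wedge R a b) = B a b := by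
  let A : M [⋀^Fin 2]→ₗ[R] N :=
    AlternatingMap.mk
      (MultilinearMap.mk' (fun v => B (v 0) (v 1))
        (fun m i x y => by fin_cases i <;> simp)
        (fun m i c x => by fin_cases i <;> simp))
      (by
        intro v i j hij hne
        have h : v 0 = v 1 := by
          fin_cases i <;> fin_cases j <;> simp_all
        simp [h, hB])
  refine ⟨exteriorPower.alternatingMapLinearEquiv A, fun a b => ?_⟩
  rw [wedge_eq_ιMulti, exteriorPower.alternatingMapLinearEquiv_apply_ιMulti]
  rfl

/-- The wedge product as a biadditive map. -/
noncomputable def wedgeAddHom (R M : Type*) [CommRing R] [AddCommGroup M] [Module R M] :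
    M →+ M →+ ⋀[R]^2 M :=
  AddMonoidHom.mk' (fun a => AddMonoidHom.mk' (wedge R a) (wedge_add_right a))
    (fun a a' => AddMonoidHom.ext (wedge_add_left a a'))

@[simp]
theorem wedgeAddHom_apply (a b : M) : wedgeAddHom R M a b = wedge R a b := rfl

/-- The antisymmetrisation of a balanced biadditive map factors through the second exterior
power. -/
theorem exists_addMonoidHom_wedge {N : Type*} [AddCommGroup N] (f : M →+ M →+ N)
    (balanced : ∀ (r : R) a b, f (r • a) b = f a (r • b)) :
    ∃ g : ⋀[R]^2 M →+ N, ∀ a b, g (wedge R a b) = f a b - f b a := by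
  let T := TensorProduct.mk R M M
  obtain ⟨s, hs⟩ := exists_linearMap_wedge (T - T.flip) (by simp)
  refine ⟨(TensorProduct.liftAddHom f balanced).comp s.toAddMonoidHom, fun a b => ?_⟩
  simp [hs, T]

end Wedge

/-- Let `K = ℚ(φ)` be an imaginary quadratic field with `φ² = −d`
(`d > 0` rational) and `V` a finite-dimensional `K`-vector space, also regarded as a
`ℚ`-vector space.  Let `φ₂` be the endomorphism of `⋀²_ℚ V` with
`φ₂(v ∧ w) = (φ·v) ∧ (φ·w)`.  Then the `ℚ`-linear map `i : ⋀²_K V → ⋀²_ℚ V` determined by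
`i(a ∧_K b) = (1/2)·a ∧ b − (1/(2d))·(φa) ∧ (φb)` is well defined and injective, and its
range is the `(−d)`-eigenspace of `φ₂`. -/
theorem exterior_square_over_K_embeds
    (d : ℚ) (hd : 0 < d)
    (K : Type*) [Field K] [Algebra ℚ K]
    (φ : K) (hφ : φ ^ 2 = algebraMap ℚ K (-d))
    (hgen : Algebra.adjoin ℚ {φ} = ⊤) (hrank : Module.finrank ℚ K = 2)
    (V : Type*) [AddCommGroup V] [Module K V] [FiniteDimensional K V]
    [Module ℚ V] [IsScalarTower ℚ K V]
    [Module ℚ (ExteriorAlgebra K V)] [IsScalarTower ℚ K (ExteriorAlgebra K V)]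
    (φ₂ : ⋀[ℚ]^2 V →ₗ[ℚ] ⋀[ℚ]^2 V)
    (hφ₂ : ∀ a b : V, φ₂ (wedge ℚ a b) = wedge ℚ (φ • a) (φ • b)) :
    ∃ i : (⋀[K]^2 V) →ₗ[ℚ] (⋀[ℚ]^2 V),
      (∀ a b : V, i (wedge K a b) =
        ((1 : ℚ)/2) • wedge ℚ a b - (1/(2*d)) • wedge ℚ (φ • a) (φ • b)) ∧
      Function.Injective i ∧
      LinearMap.range i = Module.End.eigenspace φ₂ (-d) := by
  have hd0 : d ≠ 0 := hd.ne'
  have hφφ (a : V) : φ • φ • a = (-d) • a := by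
    rw [smul_smul, ← pow_two, hφ, algebraMap_smul]
  have hφ₂φ₂ (w : ⋀[ℚ]^2 V) : φ₂ (φ₂ w) = (d * d) • w := by
    induction w using wedge_induction with
    | zero => simp
    | mem a b =>
      rw [hφ₂, hφ₂, hφφ, hφφ, wedge_smul_left, wedge_smul_right, smul_smul, neg_mul_neg]
    | add x y hx hy => simp only [map_add, hx, hy, smul_add]
  let p : ⋀[ℚ]^2 V →ₗ[ℚ] ⋀[ℚ]^2 V := ((1 : ℚ) / 2) • LinearMap.id - (1 / (2 * d)) • φ₂
  have hp (w) : p w = ((1 : ℚ) / 2) • w - (1 / (2 * d)) • φ₂ w := rfl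
  have balanced (k : K) : ∀ a b : V, p (wedge ℚ (k • a) b) = p (wedge ℚ a (k • b)) := by
    have hk : k ∈ Algebra.adjoin ℚ {φ} := hgen ▸ Algebra.mem_top
    induction hk using Algebra.adjoin_induction with
    | mem x hx =>
      obtain rfl := Set.mem_singleton_iff.mp hx
      intro a b
      rw [hp, hp, hφ₂, hφ₂, hφφ, hφφ, wedge_smul_left, wedge_smul_right]
      match_scalars <;> field_simp
    | algebraMap q =>
      intro a b
      rw [algebraMap_smul, algebraMap_smul, wedge_smul_left, wedge_smul_right]
    | add x y _ _ hx hy =>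
      intro a b
      rw [add_smul, add_smul, wedge_add_left, wedge_add_right, map_add, map_add, hx, hy]
    | mul x y _ _ hx hy =>
      intro a b
      rw [mul_smul, hx, hy, smul_smul, mul_comm]
  obtain ⟨g, hg⟩ := exists_addMonoidHom_wedge (R := K)
    ((AddMonoidHom.compHom p.toAddMonoidHom).comp (wedgeAddHom ℚ V)) balanced
  let i : ⋀[K]^2 V →ₗ[ℚ] ⋀[ℚ]^2 V := ((1 : ℚ) / 2) • g.toRatLinearMap
  have hi (a b : V) : i (wedge K a b) = p (wedge ℚ a b) := by
    have h : i (wedge K a b) = ((1 : ℚ) / 2) • (p (wedge ℚ a b) - p (wedge ℚ b a)) :=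
      congrArg (((1 : ℚ) / 2) • ·) (hg a b)
    rw [h, wedge_swap a b, map_neg]
    module
  obtain ⟨r, hr⟩ : ∃ r : ⋀[ℚ]^2 V →ₗ[ℚ] ⋀[K]^2 V, ∀ a b, r (wedge ℚ a b) = wedge K a b :=
    exists_linearMap_wedge
      ((AddMonoidHom.mk' (fun a => (wedgeAddHom K V a).toRatLinearMap)
        (fun a a' => LinearMap.ext fun b => by simp)).toRatLinearMap)
      wedge_self
  have hri (w) : r (i w) = w := by
    induction w using wedge_induction with
    | zero => simp
    | mem a b =>
      have h : r (wedge ℚ (φ • a) (φ • b)) = r ((-d) • wedge ℚ a b) := by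
        rw [← wedge_smul_left, hr, hr, wedge_smul_right, ← wedge_smul_left, hφφ]
      rw [hi, hp, hφ₂, map_sub, r.map_smul (1 / (2 * d)), h, ← r.map_smul, ← map_sub, ← hr]
      congr 1
      match_scalars
      field_simp
      norm_num
    | add x y hx hy => rw [map_add, map_add, hx, hy]
  have hir (w) : i (r w) = p w := by
    induction w using wedge_induction with
    | zero => simp
    | mem a b => rw [hr, hi]
    | add x y hx hy => rw [map_add, map_add, map_add, hx, hy]
  refine ⟨i, fun a b => by rw [hi, hp, hφ₂], Function.LeftInverse.injective hri, ?_⟩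
  ext w
  rw [LinearMap.mem_range, Module.End.mem_eigenspace_iff]
  constructor
  · rintro ⟨x, rfl⟩
    rw [← hri x, hir, hp, map_sub, map_smul, map_smul, hφ₂φ₂]
    match_scalars <;> field_simp
  · intro hw
    refine ⟨r w, ?_⟩
    rw [hir, hp, hw]
    match_scalars
    field_simp
    norm_num
end

section
/- Let l and m be negative rational numbers, and let Q be the quadratic form on ℚ⁶ given by Q(x) = 2x₁² − 2x₂² + 2x₃² − 2x₄² + l·x₅² + m·x₆². Let e₁, …, e₆ be the standard basis of ℚ⁶ and let z = e₁e₂e₃e₄e₅e₆ be the product of their images in the Clifford algebra C(Q). Then z lies in the even Clifford algebra C⁺(Q), z² = −16·l·m (as a scalar in C⁺(Q)), and the center of the ℚ-algebra C⁺(Q) equals the ℚ-subalgebra generated by z (which is isomorphic to the imaginary quadratic field ℚ(√(−lm))). -/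
open Polynomial

namespace CliffordAlgebra

section Orthogonal

variable {K V κ : Type*} [Field K] [AddCommGroup V] [Module K V] {Q : QuadraticForm K V}

theorem involute_eq_self_of_mem_even {x : CliffordAlgebra Q} (hx : x ∈ even Q) :
    involute x = x := by
  induction x, hx using even_induction with
  | algebraMap r => simp
  | add x y hx hy ihx ihy => rw [map_add, ihx, ihy]
  | ι_mul_ι_mul m₁ m₂ x hx ih => simp [ih]

theorem involute_mem_adjoin_image {v : κ → V} {S : Set κ} {a : CliffordAlgebra Q}
    (ha : a ∈ Algebra.adjoin K ((fun j => ι Q (v j)) '' S)) :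
    involute a ∈ Algebra.adjoin K ((fun j => ι Q (v j)) '' S) := by
  induction ha using Algebra.adjoin_induction with
  | mem x hx =>
    obtain ⟨j, hj, rfl⟩ := hx
    simpa using Algebra.subset_adjoin (R := K) (Set.mem_image_of_mem (fun j => ι Q (v j)) hj)
  | algebraMap r => simp
  | add x y _ _ ihx ihy => rw [map_add]; exact add_mem ihx ihy
  | mul x y _ _ ihx ihy => rw [map_mul]; exact mul_mem ihx ihy

/-- Commuting with `ι Q w` up to the grade involution passes to generated subalgebras. -/
theorem mul_ι_of_mem_adjoin {s : Set (CliffordAlgebra Q)} {w : V}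
    (hs : ∀ x ∈ s, x * ι Q w = ι Q w * involute x) {a : CliffordAlgebra Q}
    (ha : a ∈ Algebra.adjoin K s) : a * ι Q w = ι Q w * involute a := by
  induction ha using Algebra.adjoin_induction with
  | mem x hx => exact hs x hx
  | algebraMap r => rw [AlgHom.commutes, Algebra.commutes]
  | add x y _ _ ihx ihy => rw [map_add, add_mul, mul_add, ihx, ihy]
  | mul x y _ _ ihx ihy => rw [map_mul, mul_assoc, ihy, ← mul_assoc, ihx, mul_assoc]

variable {v : κ → V} (hv : Pairwise fun i j => Q.IsOrtho (v i) (v j))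

include hv in
theorem mul_ι_of_mem_adjoin_image {S : Set κ} {i : κ} (hi : i ∉ S) {a : CliffordAlgebra Q}
    (ha : a ∈ Algebra.adjoin K ((fun j => ι Q (v j)) '' S)) :
    a * ι Q (v i) = ι Q (v i) * involute a := by
  refine mul_ι_of_mem_adjoin ?_ ha
  rintro _ ⟨j, hj, rfl⟩
  have hji : j ≠ i := fun h => hi (h ▸ hj)
  simpa using ι_mul_ι_comm_of_isOrtho (hv hji)

include hv in
theorem exists_eq_add_ι_mul_of_mem_adjoin_insert {S : Set κ} {i : κ} (hi : i ∉ S)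
    {x : CliffordAlgebra Q}
    (hx : x ∈ Algebra.adjoin K ((fun j => ι Q (v j)) '' insert i S)) :
    ∃ a ∈ Algebra.adjoin K ((fun j => ι Q (v j)) '' S),
      ∃ b ∈ Algebra.adjoin K ((fun j => ι Q (v j)) '' S), x = a + ι Q (v i) * b := by
  induction hx using Algebra.adjoin_induction with
  | mem x hx =>
    obtain ⟨j, rfl | hj, rfl⟩ := hx
    · exact ⟨0, zero_mem _, 1, one_mem _, by simp⟩
    · exact ⟨_, Algebra.subset_adjoin (Set.mem_image_of_mem _ hj), 0, zero_mem _, by simp⟩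
  | algebraMap r => exact ⟨_, Subalgebra.algebraMap_mem _ r, 0, zero_mem _, by simp⟩
  | add x y _ _ ihx ihy =>
    obtain ⟨a, ha, b, hb, rfl⟩ := ihx
    obtain ⟨c, hc, d, hd, rfl⟩ := ihy
    exact ⟨a + c, add_mem ha hc, b + d, add_mem hb hd, by rw [mul_add]; abel⟩
  | mul x y _ _ ihx ihy =>
    obtain ⟨a, ha, b, hb, rfl⟩ := ihx
    obtain ⟨c, hc, d, hd, rfl⟩ := ihy
    refine ⟨a * c + algebraMap K _ (Q (v i)) * (involute b * d),
      add_mem (mul_mem ha hc) (mul_mem (Subalgebra.algebraMap_mem _ _)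
        (mul_mem (involute_mem_adjoin_image hb) hd)),
      b * c + involute a * d,
      add_mem (mul_mem hb hc) (mul_mem (involute_mem_adjoin_image ha) hd), ?_⟩
    have h₁ : a * (ι Q (v i) * d) = ι Q (v i) * (involute a * d) := by
      rw [← mul_assoc, mul_ι_of_mem_adjoin_image hv hi ha, mul_assoc]
    have h₂ : ι Q (v i) * b * (ι Q (v i) * d) =
        algebraMap K _ (Q (v i)) * (involute b * d) := by
      rw [← ι_sq_scalar, mul_assoc, ← mul_assoc b, mul_ι_of_mem_adjoin_image hv hi hb]
      simp only [mul_assoc]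
    rw [add_mul, mul_add, mul_add, h₁, h₂, mul_add, mul_assoc]
    abel

include hv in
theorem mem_adjoin_of_commute_of_mem_adjoin_insert [NeZero (2 : K)] {S : Set κ} {i : κ}
    (hi : i ∉ S) (hQ : Q (v i) ≠ 0) {x : CliffordAlgebra Q}
    (hx : x ∈ Algebra.adjoin K ((fun j => ι Q (v j)) '' insert i S))
    (hxi : involute x = x) (hc : Commute (ι Q (v i)) x) :
    x ∈ Algebra.adjoin K ((fun j => ι Q (v j)) '' S) := by
  obtain ⟨a, ha, b, hb, hab⟩ := exists_eq_add_ι_mul_of_mem_adjoin_insert hv hi hx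
  have ha' := involute_mem_adjoin_image ha
  have hb' := involute_mem_adjoin_image hb
  have hcomm : x * ι Q (v i) = (involute a + ι Q (v i) * involute b) * ι Q (v i) := by
    rw [← hc.eq, hab, add_mul, mul_add, mul_assoc, mul_ι_of_mem_adjoin_image hv hi ha',
      mul_ι_of_mem_adjoin_image hv hi hb', involute_involute, involute_involute]
  have hx₁ : x = involute a + ι Q (v i) * involute b := by
    have h := congrArg (· * ι Q (v i)) hcomm
    simp only [mul_assoc, ι_sq_scalar] at h
    rw [← Algebra.commutes, ← Algebra.commutes, ← Algebra.smul_def, ← Algebra.smul_def] at h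
    exact smul_right_injective _ hQ h
  have hx₂ : x = involute a - ι Q (v i) * involute b := by
    conv_lhs => rw [← hxi, hab]
    simp [sub_eq_add_neg]
  have hx₃ : (2 : K) • x = (2 : K) • involute a := by
    rw [two_smul, two_smul]
    nth_rewrite 1 [hx₁]
    rw [hx₂]
    abel
  rw [smul_right_injective _ (NeZero.ne (2 : K)) hx₃]
  exact ha'

include hv in
/-- An even element commuting with a nondegenerate orthogonal generating family is a scalar. -/
theorem mem_bot_of_commute_of_involute_eq_self [NeZero (2 : K)] [Finite κ]
    (hQ : ∀ i, Q (v i) ≠ 0)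
    (hgen : Algebra.adjoin K (Set.range fun j => ι Q (v j)) = ⊤) {x : CliffordAlgebra Q}
    (hxi : involute x = x) (hc : ∀ i, Commute (ι Q (v i)) x) :
    x ∈ (⊥ : Subalgebra K (CliffordAlgebra Q)) := by
  have key : ∀ S : Set κ, S.Finite → x ∈ Algebra.adjoin K ((fun j => ι Q (v j)) '' S) →
      x ∈ (⊥ : Subalgebra K (CliffordAlgebra Q)) := by
    intro S hS
    induction S, hS using Set.Finite.induction_on with
    | empty => simp
    | insert hi _ ih =>
      exact fun h => ih (mem_adjoin_of_commute_of_mem_adjoin_insert hv hi (hQ _) h hxi (hc _))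
  refine key Set.univ Set.finite_univ ?_
  rw [Set.image_univ, hgen]
  trivial

/-- An element anticommuting with a generating set of vectors commutes with even elements. -/
theorem mul_eq_involute_mul_of_anticommute
    (hgen : Algebra.adjoin K (Set.range fun j => ι Q (v j)) = ⊤) {z : CliffordAlgebra Q}
    (hz : ∀ i, ι Q (v i) * z = -(z * ι Q (v i))) (x : CliffordAlgebra Q) :
    z * x = involute x * z := by
  have hx : x ∈ Algebra.adjoin K (Set.range fun j => ι Q (v j)) := hgen ▸ trivial
  induction hx using Algebra.adjoin_induction with
  | mem x hx =>
    obtain ⟨j, rfl⟩ := hx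
    simp [hz]
  | algebraMap r => rw [AlgHom.commutes, Algebra.commutes]
  | add x y _ _ ihx ihy => rw [map_add, mul_add, add_mul, ihx, ihy]
  | mul x y _ _ ihx ihy => rw [map_mul, ← mul_assoc, ihx, mul_assoc, ihy, mul_assoc]

include hv in
/-- If an even element `z` with invertible scalar square anticommutes with a nondegenerate
orthogonal generating family, then it generates the center of the even Clifford algebra. -/
theorem center_even_eq_adjoin_of_anticommute [NeZero (2 : K)] [Finite κ] [Nonempty κ]
    (hQ : ∀ i, Q (v i) ≠ 0)
    (hgen : Algebra.adjoin K (Set.range fun j => ι Q (v j)) = ⊤)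
    (z : even Q) (hz : ∀ i, ι Q (v i) * (z : CliffordAlgebra Q) = -(z * ι Q (v i)))
    {d : K} (hd : d ≠ 0) (hzd : (z : CliffordAlgebra Q) * z = algebraMap K _ d) :
    Subalgebra.center K (even Q) = Algebra.adjoin K {z} := by
  have hinv := fun y : even Q => involute_eq_self_of_mem_even y.2
  apply le_antisymm
  · intro x hx
    rw [Subalgebra.mem_center_iff] at hx
    obtain ⟨k⟩ := ‹Nonempty κ›
    have hcomm : ∀ i j, ι Q (v i) * ι Q (v j) * (x : CliffordAlgebra Q) =
        x * (ι Q (v i) * ι Q (v j)) := fun i j =>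
      congrArg Subtype.val (hx ⟨_, ι_mul_ι_mem_evenOdd_zero Q (v i) (v j)⟩)
    set y : CliffordAlgebra Q := (Q (v k))⁻¹ • (ι Q (v k) * x * ι Q (v k)) with hy
    have hsq : ∀ w : CliffordAlgebra Q, (Q (v k))⁻¹ • (ι Q (v k) * ι Q (v k) * w) = w := by
      intro w
      rw [ι_sq_scalar, ← Algebra.smul_def, inv_smul_smul₀ (hQ k)]
    have hsq' : ∀ w : CliffordAlgebra Q, (Q (v k))⁻¹ • (w * (ι Q (v k) * ι Q (v k))) = w := by
      intro w
      rw [ι_sq_scalar, ← Algebra.commutes, ← Algebra.smul_def, inv_smul_smul₀ (hQ k)]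
    have hy₁ : ∀ i, y * ι Q (v i) = ι Q (v i) * x := by
      intro i
      rw [hy, smul_mul_assoc, mul_assoc, mul_assoc, ← hcomm, ← mul_assoc, ← mul_assoc,
        mul_assoc (_ * _), hsq]
    have hy₂ : ∀ i, ι Q (v i) * y = x * ι Q (v i) := by
      intro i
      rw [hy, mul_smul_comm, ← mul_assoc, ← mul_assoc, hcomm, mul_assoc, mul_assoc,
        ← mul_assoc, hsq']
    have hyi : involute y = y := by simp [hy, hinv x]
    obtain ⟨r, hr⟩ := Algebra.mem_bot.1 <| mem_bot_of_commute_of_involute_eq_self hv hQ hgen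
      (x := x + y) (by rw [map_add, hinv, hyi]) fun i => by
        rw [Commute, SemiconjBy, mul_add, add_mul, hy₁, hy₂, add_comm]
    obtain ⟨s, hs⟩ := Algebra.mem_bot.1 <| mem_bot_of_commute_of_involute_eq_self hv hQ hgen
      (x := (x - y) * z) (by rw [map_mul, map_sub, hinv, hinv, hyi]) fun i => by
        have hanti : ι Q (v i) * (x - y) = -((x - y) * ι Q (v i)) := by
          rw [mul_sub, hy₂, sub_mul, hy₁, neg_sub]
        rw [Commute, SemiconjBy, ← mul_assoc, hanti, neg_mul, mul_assoc, hz, mul_neg, neg_neg,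
          mul_assoc]
    have hxy : (x : CliffordAlgebra Q) - y = (d⁻¹ * s) • (z : CliffordAlgebra Q) := by
      have h := congrArg (· * (z : CliffordAlgebra Q)) hs
      simp only [mul_assoc, hzd] at h
      rw [← Algebra.commutes d, ← Algebra.smul_def, ← Algebra.smul_def] at h
      rw [mul_smul, h, inv_smul_smul₀ hd]
    have hx2 : x = (2 : K)⁻¹ • (algebraMap K (even Q) r + (d⁻¹ * s) • z) := by
      apply Subtype.ext
      change (x : CliffordAlgebra Q) =
        (2 : K)⁻¹ • (algebraMap K (CliffordAlgebra Q) r + (d⁻¹ * s) • (z : CliffordAlgebra Q))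
      rw [← hxy, hr, add_add_sub_cancel, ← two_smul K, inv_smul_smul₀ (NeZero.ne (2 : K))]
    rw [hx2]
    exact Subalgebra.smul_mem _ (add_mem (Subalgebra.algebraMap_mem _ _)
      (Subalgebra.smul_mem _ (Algebra.self_mem_adjoin_singleton K z) _)) _
  · rw [Algebra.adjoin_le_iff, Set.singleton_subset_iff, SetLike.mem_coe,
      Subalgebra.mem_center_iff]
    intro b
    apply Subtype.ext
    have h := mul_eq_involute_mul_of_anticommute hgen hz (b : CliffordAlgebra Q)
    rw [hinv] at h
    exact h.symm

end Orthogonal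

theorem adjoin_range_ι_basis {R M κ : Type*} [CommRing R] [AddCommGroup M] [Module R M]
    (Q : QuadraticForm R M) (b : Module.Basis κ R M) :
    Algebra.adjoin R (Set.range fun j => ι Q (b j)) = ⊤ := by
  rw [eq_top_iff, ← adjoin_range_ι, Algebra.adjoin_le_iff]
  rintro _ ⟨m, rfl⟩
  have hm : m ∈ Submodule.span R (Set.range b) := b.span_eq ▸ trivial
  have h := Submodule.mem_map_of_mem (f := ι Q) hm
  rw [Submodule.map_span, ← Set.range_comp] at h
  exact Algebra.span_le_adjoin R _ h

end CliffordAlgebra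

/-- If a nonzero scalar multiple of `z` is a root of an irreducible polynomial `p`, then `z`
generates a copy of `K[X] / (p)`. -/
theorem Algebra.nonempty_adjoin_singleton_algEquiv_adjoinRoot {K A : Type*} [Field K] [Ring A]
    [Nontrivial A] [Algebra K A] {p : K[X]} (hp : Irreducible p) {c : K} (hc : c ≠ 0) {z : A}
    (hz : aeval (c • z) p = 0) :
    Nonempty (Algebra.adjoin K {z} ≃ₐ[K] AdjoinRoot p) := by
  have := Fact.mk hp
  let f : AdjoinRoot p →ₐ[K] A := Ideal.Quotient.liftₐ (Ideal.span {p}) (aeval (c • z)) (by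
    intro a ha
    obtain ⟨q, rfl⟩ := Ideal.mem_span_singleton.1 ha
    rw [map_mul, hz, zero_mul])
  have hf : ∀ q, f (AdjoinRoot.mk p q) = aeval (c • z) q := fun q => rfl
  have hrange : f.range = Algebra.adjoin K {z} := by
    have h₁ : f.range = Algebra.adjoin K {c • z} := by
      rw [Algebra.adjoin_singleton_eq_range_aeval]
      ext a
      constructor
      · rintro ⟨q, rfl⟩
        obtain ⟨q, rfl⟩ := AdjoinRoot.mk_surjective q
        exact ⟨q, (hf q).symm⟩
      · rintro ⟨q, rfl⟩
        exact ⟨AdjoinRoot.mk p q, hf q⟩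
    rw [h₁]
    apply le_antisymm <;> rw [Algebra.adjoin_le_iff, Set.singleton_subset_iff]
    · exact Subalgebra.smul_mem _ (Algebra.self_mem_adjoin_singleton K z) c
    · have h := Subalgebra.smul_mem _ (Algebra.self_mem_adjoin_singleton K (c • z)) c⁻¹
      rwa [inv_smul_smul₀ hc] at h
  exact ⟨((AlgEquiv.ofInjective f f.toRingHom.injective).trans
    (Subalgebra.equivOfEq _ _ hrange)).symm⟩

theorem Polynomial.irreducible_X_sq_add_C_of_pos {K : Type*} [Field K] [LinearOrder K]
    [IsStrictOrderedRing K] {a : K} (ha : 0 < a) : Irreducible ((X : K[X]) ^ 2 + C a) := by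
  rw [irreducible_iff_roots_eq_zero_of_degree_le_three]
  · refine Multiset.eq_zero_of_forall_notMem fun x hx => ?_
    have h := isRoot_of_mem_roots hx
    simp only [IsRoot.def, eval_add, eval_pow, eval_X, eval_C] at h
    exact absurd h (by positivity)
  · rw [natDegree_X_pow_add_C]
  · rw [natDegree_X_pow_add_C]; norm_num

section Anticommuting

variable {R A : Type*} [CommRing R] [Ring A] [Algebra R A] {e : Fin 6 → A}
  (he : Pairwise fun i j => e i * e j = -(e j * e i))

include he in
/-- Each of six pairwise anticommuting elements anticommutes with their product. -/
theorem anticommute_prod_six (i : Fin 6) :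
    e i * (e 0 * e 1 * e 2 * e 3 * e 4 * e 5) = -(e 0 * e 1 * e 2 * e 3 * e 4 * e 5 * e i) := by
  have hs : ∀ i j, j < i → e i * e j = -(e j * e i) := fun i j hij => he hij.ne'
  have hs' : ∀ i j, j < i → ∀ x, e i * (e j * x) = -(e j * (e i * x)) := fun i j hij x => by
    rw [← mul_assoc, hs i j hij, neg_mul, mul_assoc]
  fin_cases i <;>
    simp only [Fin.mk_zero, Fin.mk_one, Fin.reduceFinMk, Fin.reduceLT, mul_assoc, hs, hs',
      mul_neg, neg_neg]

include he in
/-- The square of the product of six anticommuting elements with scalar squares. -/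
theorem prod_six_mul_self {q : Fin 6 → R} (hq : ∀ i, e i * e i = algebraMap R A (q i)) :
    e 0 * e 1 * e 2 * e 3 * e 4 * e 5 * (e 0 * e 1 * e 2 * e 3 * e 4 * e 5) =
      algebraMap R A (-(∏ i, q i)) := by
  have hs : ∀ i j, j < i → e i * e j = -(e j * e i) := fun i j hij => he hij.ne'
  have hs' : ∀ i j, j < i → ∀ x, e i * (e j * x) = -(e j * (e i * x)) := fun i j hij x => by
    rw [← mul_assoc, hs i j hij, neg_mul, mul_assoc]
  have hq' : ∀ i x, e i * (e i * x) = algebraMap R A (q i) * x := fun i x => by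
    rw [← mul_assoc, hq]
  simp only [Fin.reduceLT, mul_assoc, hs', mul_neg, neg_neg]
  simp only [hq', hq, Fin.prod_univ_six, map_neg, map_mul, mul_assoc]

end Anticommuting

/-- For negative rationals `l, m` and the diagonal quadratic form
`Q = ⟨2⟩ ⊕ ⟨−2⟩ ⊕ ⟨2⟩ ⊕ ⟨−2⟩ ⊕ ⟨l⟩ ⊕ ⟨m⟩` on `ℚ⁶`, the product `z = e₁e₂e₃e₄e₅e₆` of the
images of the standard basis vectors in the Clifford algebra `C(Q)` lies in the even
Clifford algebra `C⁺(Q)`, satisfies `z² = −16·l·m` (as a scalar), and the center of the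
`ℚ`-algebra `C⁺(Q)` equals the `ℚ`-subalgebra generated by `z`, which is isomorphic to the
imaginary quadratic field `ℚ(√(−l·m)) = ℚ[X]/(X² + l·m)`. -/
theorem clifford_z_center
    (l m : ℚ) (hl : l < 0) (hm : m < 0)
    (Q : QuadraticForm ℚ (Fin 6 → ℚ))
    (hQ : ∀ x : Fin 6 → ℚ,
      Q x = 2 * x 0 ^ 2 - 2 * x 1 ^ 2 + 2 * x 2 ^ 2 - 2 * x 3 ^ 2
        + l * x 4 ^ 2 + m * x 5 ^ 2)
    (z : CliffordAlgebra Q)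
    (hz : z = CliffordAlgebra.ι Q (Pi.single (0 : Fin 6) (1 : ℚ)) *
              CliffordAlgebra.ι Q (Pi.single (1 : Fin 6) (1 : ℚ)) *
              CliffordAlgebra.ι Q (Pi.single (2 : Fin 6) (1 : ℚ)) *
              CliffordAlgebra.ι Q (Pi.single (3 : Fin 6) (1 : ℚ)) *
              CliffordAlgebra.ι Q (Pi.single (4 : Fin 6) (1 : ℚ)) *
              CliffordAlgebra.ι Q (Pi.single (5 : Fin 6) (1 : ℚ))) :
    ∃ hmem : z ∈ CliffordAlgebra.even Q,
      z * z = algebraMap ℚ (CliffordAlgebra Q) (-(16 * l * m)) ∧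
      Subalgebra.center ℚ (CliffordAlgebra.even Q) =
        Algebra.adjoin ℚ {(⟨z, hmem⟩ : CliffordAlgebra.even Q)} ∧
      Nonempty ((Algebra.adjoin ℚ {(⟨z, hmem⟩ : CliffordAlgebra.even Q)}) ≃ₐ[ℚ]
        AdjoinRoot ((X : ℚ[X]) ^ 2 + C (l * m))) := by
  let b := Pi.basisFun ℚ (Fin 6)
  have hb : ∀ i, b i = Pi.single i 1 := Pi.basisFun_apply ℚ (Fin 6)
  let q : Fin 6 → ℚ := ![2, -2, 2, -2, l, m]
  have hq : ∀ i, Q (b i) = q i := by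
    intro i
    rw [hb, hQ]
    fin_cases i <;> simp [q]
  have hq₀ : ∀ i, Q (b i) ≠ 0 := by
    intro i
    rw [hq]
    fin_cases i <;> simp [q, hl.ne, hm.ne]
  have hortho : Pairwise fun i j => Q.IsOrtho (b i) (b j) := by
    intro i j hij
    rw [QuadraticMap.isOrtho_def, hb, hb, hQ, hQ, hQ]
    have h : ∀ k, (Pi.single i 1 : Fin 6 → ℚ) k * (Pi.single j 1 : Fin 6 → ℚ) k = 0 := by
      intro k
      rcases eq_or_ne k i with rfl | hk
      · rw [Pi.single_eq_of_ne hij, mul_zero]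
      · rw [Pi.single_eq_of_ne hk, zero_mul]
    simp only [Pi.add_apply]
    linear_combination 4 * h 0 - 4 * h 1 + 4 * h 2 - 4 * h 3 + 2 * l * h 4 + 2 * m * h 5
  have hanti : Pairwise fun i j =>
      CliffordAlgebra.ι Q (b i) * CliffordAlgebra.ι Q (b j) =
        -(CliffordAlgebra.ι Q (b j) * CliffordAlgebra.ι Q (b i)) :=
    fun i j hij => CliffordAlgebra.ι_mul_ι_comm_of_isOrtho (hortho hij)
  simp only [← hb] at hz
  have hmem : z ∈ CliffordAlgebra.even Q := by
    have h (i j : Fin 6) : CliffordAlgebra.ι Q (b i) * CliffordAlgebra.ι Q (b j) ∈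
        CliffordAlgebra.even Q := CliffordAlgebra.ι_mul_ι_mem_evenOdd_zero Q _ _
    have h' := mul_mem (mul_mem (h 0 1) (h 2 3)) (h 4 5)
    rw [hz]
    simpa only [mul_assoc] using h'
  have hsq : z * z = algebraMap ℚ (CliffordAlgebra Q) (-(16 * l * m)) := by
    rw [hz, prod_six_mul_self hanti (q := q) fun i => by
      rw [CliffordAlgebra.ι_sq_scalar, hq]]
    congr 2
    rw [Fin.prod_univ_six]
    change 2 * -2 * 2 * -2 * l * m = 16 * l * m
    ring
  have hlm : 0 < l * m := mul_pos_of_neg_of_neg hl hm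
  refine ⟨hmem, hsq, ?_, ?_⟩
  · refine CliffordAlgebra.center_even_eq_adjoin_of_anticommute hortho hq₀
      (CliffordAlgebra.adjoin_range_ι_basis Q b) _ (fun i => ?_) (d := -(16 * l * m)) ?_ hsq
    · simpa only [hz] using anticommute_prod_six hanti i
    · linarith
  · have : Invertible (2 : ℚ) := invertibleOfNonzero two_ne_zero
    refine Algebra.nonempty_adjoin_singleton_algEquiv_adjoinRoot
      (Polynomial.irreducible_X_sq_add_C_of_pos hlm) (c := 1 / 4) (by norm_num) ?_
    apply Subtype.ext
    have h : aeval ((1 / 4 : ℚ) • z) ((X : ℚ[X]) ^ 2 + C (l * m)) = 0 := by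
      rw [map_add, map_pow, aeval_X, aeval_C, sq, smul_mul_smul_comm, hsq, Algebra.smul_def,
        ← map_mul, ← map_add]
      convert map_zero (algebraMap ℚ (CliffordAlgebra Q)) using 2
      ring
    simpa using h
end

section
/- Let Q be the quadratic form on ℚ⁴ given by Q(x) = 2x₁x₂ + 2x₃x₄ (the orthogonal sum Hyp ⊕ Hyp of two hyperbolic planes). Then the even Clifford algebra C⁺(Q) is isomorphic as a ℚ-algebra to the product M₂(ℚ) × M₂(ℚ) of two copies of the algebra of 2×2 rational matrices. -/
namespace HypHyp

open Matrix CliffordAlgebra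

/-- A vector of `ℚ⁴` as a `2 × 2` matrix whose determinant is `2 x₀ x₁ + 2 x₂ x₃`. -/
def toMat : (Fin 4 → ℚ) →ₗ[ℚ] Matrix (Fin 2) (Fin 2) ℚ where
  toFun x := !![2 * x 0, 2 * x 2; -x 3, x 1]
  map_add' x y := by
    ext i j; fin_cases i <;> fin_cases j <;> simp <;> ring
  map_smul' r x := by
    ext i j; fin_cases i <;> fin_cases j <;> simp <;> ring

/-- The adjugate of `toMat x`. -/
def toAdj : (Fin 4 → ℚ) →ₗ[ℚ] Matrix (Fin 2) (Fin 2) ℚ where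
  toFun x := !![x 1, -2 * x 2; x 3, 2 * x 0]
  map_add' x y := by
    ext i j; fin_cases i <;> fin_cases j <;> simp <;> ring
  map_smul' r x := by
    ext i j; fin_cases i <;> fin_cases j <;> simp <;> ring

theorem toMat_apply (x : Fin 4 → ℚ) : toMat x = !![2 * x 0, 2 * x 2; -x 3, x 1] := rfl

theorem toAdj_apply (x : Fin 4 → ℚ) : toAdj x = !![x 1, -2 * x 2; x 3, 2 * x 0] := rfl

theorem toMat_mul_toAdj (x : Fin 4 → ℚ) :
    toMat x * toAdj x = (2 * x 0 * x 1 + 2 * x 2 * x 3) • 1 := by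
  ext i j
  fin_cases i <;> fin_cases j <;> simp [toMat_apply, toAdj_apply, Matrix.mul_apply] <;> ring

theorem toAdj_mul_toMat (x : Fin 4 → ℚ) :
    toAdj x * toMat x = (2 * x 0 * x 1 + 2 * x 2 * x 3) • 1 := by
  ext i j
  fin_cases i <;> fin_cases j <;> simp [toMat_apply, toAdj_apply, Matrix.mul_apply] <;> ring

/-- The action of products of two vectors on the two half-spin representations. -/
def evenHom (Q : QuadraticForm ℚ (Fin 4 → ℚ))
    (hQ : ∀ x : Fin 4 → ℚ, Q x = 2 * x 0 * x 1 + 2 * x 2 * x 3) :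
    EvenHom Q (Matrix (Fin 2) (Fin 2) ℚ × Matrix (Fin 2) (Fin 2) ℚ) where
  bilin := LinearMap.mk₂ ℚ (fun u v => (toMat u * toAdj v, toAdj u * toMat v))
    (fun _ _ _ => by simp [add_mul]) (fun _ _ _ => by simp)
    (fun _ _ _ => by simp [mul_add]) (fun _ _ _ => by simp)
  contract m := by
    simp [toMat_mul_toAdj, toAdj_mul_toMat, hQ, Algebra.algebraMap_eq_smul_one, Prod.ext_iff]
  contract_mid u v w := by
    have h₁ : toMat u * toAdj v * (toMat v * toAdj w) = Q v • (toMat u * toAdj w) := by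
      rw [mul_assoc, ← mul_assoc (toAdj v), toAdj_mul_toMat, ← hQ]; simp
    have h₂ : toAdj u * toMat v * (toAdj v * toMat w) = Q v • (toAdj u * toMat w) := by
      rw [mul_assoc, ← mul_assoc (toMat v), toMat_mul_toAdj, ← hQ]; simp
    simp [h₁, h₂]

theorem evenHom_bilin (Q : QuadraticForm ℚ (Fin 4 → ℚ))
    (hQ : ∀ x : Fin 4 → ℚ, Q x = 2 * x 0 * x 1 + 2 * x 2 * x 3) (u v : Fin 4 → ℚ) :
    (evenHom Q hQ).bilin u v = (toMat u * toAdj v, toAdj u * toMat v) := rfl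

/-- Four elements of an algebra form two commuting hyperbolic pairs `(a, b)`, `(c, d)`. -/
structure HypRel {A : Type*} [Ring A] (a b c d : A) : Prop where
  aa : a * a = 0
  bb : b * b = 0
  cc : c * c = 0
  dd : d * d = 0
  ab : a * b = 2 - b * a
  cd : c * d = 2 - d * c
  ca : c * a = -(a * c)
  db : d * b = -(b * d)
  ad : a * d = -(d * a)
  cb : c * b = -(b * c)

section Spinors

variable {A : Type*} [Ring A] [Algebra ℚ A] {a b c d : A}

theorem HypRel.mul_even_left (h : HypRel a b c d) (x : Fin 4 → ℚ) :
    (x 0 • a + x 1 • b + x 2 • c + x 3 • d) * (a * c) =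
      x 1 • (b * (a * c)) + x 3 • (d * (a * c)) := by
  have h₁ : a * (a * c) = 0 := by rw [← mul_assoc, h.aa, zero_mul]
  have h₂ : c * (a * c) = 0 := by rw [← mul_assoc, h.ca, neg_mul, mul_assoc, h.cc]; simp
  simp [add_mul, h₁, h₂]

theorem HypRel.mul_even_right (h : HypRel a b c d) (x : Fin 4 → ℚ) :
    (x 0 • a + x 1 • b + x 2 • c + x 3 • d) * (b * (d * (a * c))) =
      (-2 * x 2) • (b * (a * c)) + (2 * x 0) • (d * (a * c)) := by
  have h₁ : a * (a * c) = 0 := by rw [← mul_assoc, h.aa, zero_mul]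
  have h₂ : c * (a * c) = 0 := by rw [← mul_assoc, h.ca, neg_mul, mul_assoc, h.cc]; simp
  have h₃ : a * (b * (d * (a * c))) = (2 : ℚ) • (d * (a * c)) := by
    rw [← mul_assoc a b, h.ab, sub_mul, mul_assoc b, ← mul_assoc a d, h.ad, neg_mul, mul_assoc d,
      h₁, two_mul, two_smul]; simp
  have h₄ : b * (b * (d * (a * c))) = 0 := by rw [← mul_assoc b b, h.bb, zero_mul]
  have h₅ : c * (b * (d * (a * c))) = (-2 : ℚ) • (b * (a * c)) := by
    rw [← mul_assoc c b, h.cb, neg_mul, mul_assoc b, ← mul_assoc c d, h.cd, sub_mul, mul_assoc d,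
      h₂, two_mul, neg_smul, two_smul]; simp [mul_add]
  have h₆ : d * (b * (d * (a * c))) = 0 := by
    rw [← mul_assoc d b, h.db, neg_mul, mul_assoc b, ← mul_assoc d d, h.dd]; simp
  simp only [add_mul, smul_mul_assoc, h₃, h₄, h₅, h₆]
  module

theorem HypRel.mul_odd_left (h : HypRel a b c d) (x : Fin 4 → ℚ) :
    (x 0 • a + x 1 • b + x 2 • c + x 3 • d) * (b * (a * c)) =
      (2 * x 0) • (a * c) + (-x 3) • (b * (d * (a * c))) := by
  have h₁ : a * (a * c) = 0 := by rw [← mul_assoc, h.aa, zero_mul]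
  have h₂ : c * (a * c) = 0 := by rw [← mul_assoc, h.ca, neg_mul, mul_assoc, h.cc]; simp
  have h₃ : a * (b * (a * c)) = (2 : ℚ) • (a * c) := by
    rw [← mul_assoc a b, h.ab, sub_mul, mul_assoc b, h₁, two_mul, two_smul]; simp
  have h₄ : b * (b * (a * c)) = 0 := by rw [← mul_assoc b b, h.bb, zero_mul]
  have h₅ : c * (b * (a * c)) = 0 := by
    rw [← mul_assoc c b, h.cb, neg_mul, mul_assoc b, h₂]; simp
  have h₆ : d * (b * (a * c)) = -(b * (d * (a * c))) := by
    rw [← mul_assoc d b, h.db, neg_mul, mul_assoc b]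
  simp only [add_mul, smul_mul_assoc, h₃, h₄, h₅, h₆]
  module

theorem HypRel.mul_odd_right (h : HypRel a b c d) (x : Fin 4 → ℚ) :
    (x 0 • a + x 1 • b + x 2 • c + x 3 • d) * (d * (a * c)) =
      (2 * x 2) • (a * c) + x 1 • (b * (d * (a * c))) := by
  have h₁ : a * (a * c) = 0 := by rw [← mul_assoc, h.aa, zero_mul]
  have h₂ : c * (a * c) = 0 := by rw [← mul_assoc, h.ca, neg_mul, mul_assoc, h.cc]; simp
  have h₃ : a * (d * (a * c)) = 0 := by
    rw [← mul_assoc a d, h.ad, neg_mul, mul_assoc d, h₁]; simp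
  have h₅ : c * (d * (a * c)) = (2 : ℚ) • (a * c) := by
    rw [← mul_assoc c d, h.cd, sub_mul, mul_assoc d, h₂, two_mul, two_smul]; simp
  have h₆ : d * (d * (a * c)) = 0 := by rw [← mul_assoc d d, h.dd, zero_mul]
  simp only [add_mul, smul_mul_assoc, h₃, h₅, h₆]
  module

/-- The combination, with coefficients the entries of `y`, of the elements of `A` that play the role
of matrix units in the two half-spin representations. -/
def ofMats (a b c d : A) (y : Matrix (Fin 2) (Fin 2) ℚ × Matrix (Fin 2) (Fin 2) ℚ) : A :=
  (-1 / 4 : ℚ) •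
    ((y.1 0 0 • (a * c) + y.1 1 0 • (b * (d * (a * c)))) * (b * d) +
      (y.1 0 1 • (a * c) + y.1 1 1 • (b * (d * (a * c)))) -
      (y.2 0 0 • (b * (a * c)) + y.2 1 0 • (d * (a * c))) * d +
      (y.2 0 1 • (b * (a * c)) + y.2 1 1 • (d * (a * c))) * b)

theorem ofMats_add (y z : Matrix (Fin 2) (Fin 2) ℚ × Matrix (Fin 2) (Fin 2) ℚ) :
    ofMats a b c d (y + z) = ofMats a b c d y + ofMats a b c d z := by
  simp only [ofMats, Prod.fst_add, Prod.snd_add, Matrix.add_apply, add_mul, smul_mul_assoc]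
  module

theorem ofMats_smul (r : ℚ) (y : Matrix (Fin 2) (Fin 2) ℚ × Matrix (Fin 2) (Fin 2) ℚ) :
    ofMats a b c d (r • y) = r • ofMats a b c d y := by
  simp only [ofMats, Prod.smul_fst, Prod.smul_snd, Matrix.smul_apply, add_mul, smul_mul_assoc,
    smul_eq_mul]
  module

theorem HypRel.ofMats_one (h : HypRel a b c d) : ofMats a b c d 1 = 1 := by
  have h₁ : a * c * (b * d) = -(a * b * (c * d)) := by
    rw [mul_assoc, ← mul_assoc c, h.cb]; noncomm_ring
  have h₂ : b * (d * (a * c)) = -(b * a * (d * c)) := by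
    rw [mul_assoc b a, ← mul_assoc a d, h.ad]; noncomm_ring
  have h₃ : d * (a * c) * b = -(a * b * (d * c)) := by
    have : a * b * (d * c) = d * (a * (b * c)) := by
      rw [← mul_assoc, mul_assoc a b d, ← neg_neg (b * d), ← h.db, mul_neg, ← mul_assoc a d, h.ad]
      noncomm_ring
    rw [this, mul_assoc, mul_assoc, h.cb]; simp
  have h₄ : b * (a * c) * d = b * a * (c * d) := by noncomm_ring
  have h₅ : a * b * (c * d) + b * a * (d * c) + b * a * (c * d) + a * b * (d * c) =
      (4 : ℚ) • (1 : A) := by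
    have h₇ : a * b * (c * d) + b * a * (d * c) + b * a * (c * d) + a * b * (d * c) =
        (a * b + b * a) * (c * d + d * c) := by noncomm_ring
    rw [h₇, h.ab, h.cd, sub_add_cancel, sub_add_cancel, ← Algebra.algebraMap_eq_smul_one,
      map_ofNat]
    norm_num
  have h₆ : ofMats a b c d 1 = (1 / 4 : ℚ) •
      (a * b * (c * d) + b * a * (d * c) + b * a * (c * d) + a * b * (d * c)) := by
    simp only [ofMats, Prod.fst_one, Prod.snd_one, Matrix.one_apply_eq,
      Matrix.one_apply_ne (show (0 : Fin 2) ≠ 1 by decide),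
      Matrix.one_apply_ne (show (1 : Fin 2) ≠ 0 by decide), one_smul, zero_smul, add_zero,
      zero_add, h₁, h₂, h₃, h₄]
    module
  rw [h₆, h₅, smul_smul]; norm_num

theorem HypRel.mul_ofMats (h : HypRel a b c d) (u v : Fin 4 → ℚ)
    (y : Matrix (Fin 2) (Fin 2) ℚ × Matrix (Fin 2) (Fin 2) ℚ) :
    (u 0 • a + u 1 • b + u 2 • c + u 3 • d) * ((v 0 • a + v 1 • b + v 2 • c + v 3 • d) *
      ofMats a b c d y) = ofMats a b c d ((toMat u * toAdj v, toAdj u * toMat v) * y) := by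
  have e₁ := h.mul_even_left
  have e₂ := h.mul_even_right
  have o₁ := h.mul_odd_left
  have o₂ := h.mul_odd_right
  simp only [ofMats]
  generalize b * (d * (a * c)) = s₂ at *
  generalize b * (a * c) = t₁ at *
  generalize d * (a * c) = t₂ at *
  generalize a * c = s₁ at *
  generalize b * d = r
  have e₁u := e₁ u
  have e₁v := e₁ v
  have e₂u := e₂ u
  have e₂v := e₂ v
  have o₁u := o₁ u
  have o₁v := o₁ v
  have o₂u := o₂ u
  have o₂v := o₂ v
  generalize u 0 • a + u 1 • b + u 2 • c + u 3 • d = U at *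
  generalize v 0 • a + v 1 • b + v 2 • c + v 3 • d = V at *
  simp only [mul_add, mul_sub, add_mul, mul_smul_comm, smul_mul_assoc, ← mul_assoc, e₁u, e₁v, e₂u,
    e₂v, o₁u, o₁v, o₂u, o₂v, toMat_apply, toAdj_apply, Prod.fst_mul, Prod.snd_mul,
    Matrix.mul_apply, Fin.sum_univ_two, Matrix.of_apply, Matrix.cons_val', Matrix.cons_val_zero,
    Matrix.cons_val_one, Matrix.cons_val_fin_one]
  module

end Spinors

theorem hypRel_ι (Q : QuadraticForm ℚ (Fin 4 → ℚ))
    (hQ : ∀ x : Fin 4 → ℚ, Q x = 2 * x 0 * x 1 + 2 * x 2 * x 3) :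
    HypRel (ι Q (Pi.single 0 1)) (ι Q (Pi.single 1 1)) (ι Q (Pi.single 2 1))
      (ι Q (Pi.single 3 1)) := by
  have anti (i j : Fin 4) := ι_mul_ι_add_swap (Q := Q) (Pi.single i 1) (Pi.single j 1)
  constructor
  · simp [hQ]
  · simp [hQ]
  · simp [hQ]
  · simp [hQ]
  · rw [eq_sub_iff_add_eq, anti]
    simp [QuadraticMap.polar, hQ, map_ofNat (algebraMap ℚ (CliffordAlgebra Q)) 2]
  · rw [eq_sub_iff_add_eq, anti]
    simp [QuadraticMap.polar, hQ, map_ofNat (algebraMap ℚ (CliffordAlgebra Q)) 2]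
  all_goals rw [eq_neg_iff_add_eq_zero, anti]; simp [QuadraticMap.polar, hQ]

theorem ι_eq (Q : QuadraticForm ℚ (Fin 4 → ℚ)) (x : Fin 4 → ℚ) :
    ι Q x = x 0 • ι Q (Pi.single 0 1) + x 1 • ι Q (Pi.single 1 1) + x 2 • ι Q (Pi.single 2 1) +
      x 3 • ι Q (Pi.single 3 1) := by
  simp only [← map_smul, ← map_add]
  congr 1
  ext i
  fin_cases i <;> simp

/-- `ofMats` is a left inverse of the half-spin representations. -/
theorem ofMats_lift (Q : QuadraticForm ℚ (Fin 4 → ℚ))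
    (hQ : ∀ x : Fin 4 → ℚ, Q x = 2 * x 0 * x 1 + 2 * x 2 * x 3) (x : even Q) :
    ofMats (ι Q (Pi.single 0 1)) (ι Q (Pi.single 1 1)) (ι Q (Pi.single 2 1))
      (ι Q (Pi.single 3 1)) (even.lift Q (evenHom Q hQ) x) = x := by
  obtain ⟨x, hx⟩ := x
  induction x, hx using even_induction with
  | algebraMap r =>
    have : (⟨algebraMap ℚ _ r, SetLike.algebraMap_mem_graded _ _⟩ : even Q) =
      algebraMap ℚ (even Q) r := rfl
    rw [this, AlgHom.commutes, Algebra.algebraMap_eq_smul_one, ofMats_smul,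
      (hypRel_ι Q hQ).ofMats_one, ← Algebra.algebraMap_eq_smul_one]
    rfl
  | add x y hx hy ihx ihy =>
    have : (⟨x + y, Submodule.add_mem _ hx hy⟩ : even Q) = (⟨x, hx⟩ : even Q) + ⟨y, hy⟩ := rfl
    rw [this, map_add, ofMats_add, ihx, ihy]
    rfl
  | ι_mul_ι_mul u v x hx ih =>
    have h : (even.lift Q (evenHom Q hQ)) ((even.ι Q).bilin u v * (⟨x, hx⟩ : even Q)) =
        (toMat u * toAdj v, toAdj u * toMat v) * even.lift Q (evenHom Q hQ) ⟨x, hx⟩ := by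
      rw [map_mul, even.lift_ι, evenHom_bilin]
    refine (congrArg _ h).trans ?_
    rw [← (hypRel_ι Q hQ).mul_ofMats, ih, ← ι_eq, ← ι_eq]
    exact (mul_assoc _ _ _).symm

theorem lift_surjective (Q : QuadraticForm ℚ (Fin 4 → ℚ))
    (hQ : ∀ x : Fin 4 → ℚ, Q x = 2 * x 0 * x 1 + 2 * x 2 * x 3) :
    Function.Surjective (even.lift Q (evenHom Q hQ)) := by
  intro y
  let B (i j : Fin 4) : even Q := (even.ι Q).bilin (Pi.single i 1) (Pi.single j 1)
  refine ⟨(-1 / 4 : ℚ) • (y.1 0 0 • (B 0 2 * B 1 3) + y.1 1 0 • (B 1 3 * B 0 2 * B 1 3) +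
    y.1 0 1 • B 0 2 + y.1 1 1 • (B 1 3 * B 0 2) - y.2 0 0 • (B 1 0 * B 2 3) -
    y.2 1 0 • (B 3 0 * B 2 3) + y.2 0 1 • (B 1 0 * B 2 1) + y.2 1 1 • (B 3 0 * B 2 1)), ?_⟩
  simp only [B, map_smul, map_add, map_sub, map_mul, even.lift_ι, evenHom_bilin, toMat_apply,
    toAdj_apply]
  ext i j <;> fin_cases i <;> fin_cases j <;> simp <;> ring

end HypHyp

/-- For the quadratic form `Q = Hyp ⊕ Hyp` on `ℚ⁴` (sum of two hyperbolic
planes), the even Clifford algebra `C⁺(Q)` is isomorphic as a `ℚ`-algebra to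
`M₂(ℚ) × M₂(ℚ)`. -/
theorem even_clifford_hyp_hyp_iso_matrix_prod
    (Q : QuadraticForm ℚ (Fin 4 → ℚ))
    (hQ : ∀ x : Fin 4 → ℚ, Q x = 2 * x 0 * x 1 + 2 * x 2 * x 3) :
    Nonempty ((CliffordAlgebra.even Q) ≃ₐ[ℚ]
      (Matrix (Fin 2) (Fin 2) ℚ × Matrix (Fin 2) (Fin 2) ℚ)) := by
  refine ⟨AlgEquiv.ofBijective (CliffordAlgebra.even.lift Q (HypHyp.evenHom Q hQ))
    ⟨fun x y hxy => Subtype.ext ?_, HypHyp.lift_surjective Q hQ⟩⟩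
  rw [← HypHyp.ofMats_lift Q hQ x, hxy, HypHyp.ofMats_lift]
end

section
/- Let l and m be negative rational numbers, let Q be the quadratic form on ℚ⁶ given by Q(x) = 2x₁x₂ + 2x₃x₄ + l·x₅² + m·x₆², let f₁, …, f₆ be the standard basis of ℚ⁶, and let β = (1/4)·f₁f₂f₃f₄ in the Clifford algebra C(Q). Then the ℚ-linear map from the even Clifford algebra C⁺(Q) to itself given by right multiplication by β, x ↦ x·β, has kernel of dimension 24 over ℚ; equivalently, its range has dimension 8 over ℚ (note dim_ℚ C⁺(Q) = 32). -/
open Module LinearMap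

/-- If an idempotent `e` is conjugate to its complement `1 - e` by a unit `w`, and `b` commutes
with both `e` and `w`, then the left ideal generated by `b` has twice the dimension of the one
generated by `e * b`. -/
theorem finrank_range_mulRight_eq_two_mul {K A : Type*} [Field K] [Ring A] [Algebra K A]
    [FiniteDimensional K A] {b e w : A} (he : e * e = e) (hw : IsUnit w)
    (hwe : w * e = (1 - e) * w) (hbe : b * e = e * b) (hbw : b * w = w * b) :
    finrank K (range (mulRight K b)) = 2 * finrank K (range (mulRight K (e * b))) := by
  have hsup : range (mulRight K (e * b)) ⊔ range (mulRight K ((1 - e) * b))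
      = range (mulRight K b) := by
    apply le_antisymm
    · refine sup_le ?_ ?_
      · rintro _ ⟨x, rfl⟩
        exact ⟨x * e, by simp [mul_assoc]⟩
      · rintro _ ⟨x, rfl⟩
        exact ⟨x * (1 - e), by simp [mul_assoc]⟩
    · rintro _ ⟨x, rfl⟩
      refine Submodule.mem_sup.2 ⟨_, ⟨x, rfl⟩, _, ⟨x, rfl⟩, ?_⟩
      simp only [mulRight_apply]
      noncomm_ring
  have hinf : range (mulRight K (e * b)) ⊓ range (mulRight K ((1 - e) * b)) = ⊥ := by
    rw [eq_bot_iff]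
    rintro _ ⟨⟨x, rfl⟩, ⟨y, hy⟩⟩
    simp only [mulRight_apply] at hy
    have hx : x * (e * b) = x * (e * b) * e := by
      rw [mul_assoc, mul_assoc, hbe, ← mul_assoc e e b, he]
    have hy' : y * ((1 - e) * b) * e = 0 := by
      rw [mul_assoc, mul_assoc, hbe, ← mul_assoc (1 - e), sub_mul, he]
      simp
    rw [Submodule.mem_bot, mulRight_apply, hx, ← hy, hy']
  have heq : finrank K (range (mulRight K ((1 - e) * b)))
      = finrank K (range (mulRight K (e * b))) := by
    obtain ⟨u, rfl⟩ := hw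
    have hconj : ∀ x : A, x * ((1 - e) * b) * u = x * u * (e * b) := fun x => by
      calc x * ((1 - e) * b) * u = x * ((1 - e) * (b * u)) := by simp only [mul_assoc]
        _ = x * ((1 - e) * u * b) := by rw [hbw]; simp only [mul_assoc]
        _ = x * u * (e * b) := by rw [← hwe]; simp only [mul_assoc]
    have hinj : Function.Injective (mulRight K (u : A)) := fun x y h => u.mul_left_inj.1 h
    have hmap : (range (mulRight K ((1 - e) * b))).map (mulRight K (u : A))
        = range (mulRight K (e * b)) := by
      ext z
      constructor
      · rintro ⟨_, ⟨x, rfl⟩, rfl⟩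
        exact ⟨x * u, (hconj x).symm⟩
      · rintro ⟨x, rfl⟩
        refine ⟨_, ⟨x * ↑u⁻¹, rfl⟩, ?_⟩
        simp only [mulRight_apply]
        rw [hconj, Units.inv_mul_cancel_right]
    rw [← hmap]
    exact (Submodule.equivMapOfInjective _ hinj (range (mulRight K ((1 - e) * b)))).finrank_eq
  have h := Submodule.finrank_sup_add_finrank_inf_eq (range (mulRight K (e * b)))
    (range (mulRight K ((1 - e) * b)))
  rw [hsup, hinf, finrank_bot, heq] at h
  omega

namespace CliffordAlgebra

section Finrank

variable {K M : Type*} [Field K] [Invertible (2 : K)] [AddCommGroup M] [Module K M]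
  [FiniteDimensional K M] (Q : QuadraticForm K M)

/-- The basis of the Clifford algebra of a form on a finite-dimensional space, transported from the
exterior algebra. -/
noncomputable def basisFinset :
    Basis (Finset (Fin (finrank K M))) K (CliffordAlgebra Q) :=
  (finBasis K M).ExteriorAlgebra.map (equivExterior Q).symm

instance finiteDimensional : FiniteDimensional K (CliffordAlgebra Q) :=
  (basisFinset Q).finiteDimensional_of_finite

theorem finrank_eq : finrank K (CliffordAlgebra Q) = 2 ^ finrank K M := by
  rw [finrank_eq_card_basis (basisFinset Q), Fintype.card_finset, Fintype.card_fin]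

/-- Right multiplication by an anisotropic vector exchanges the even and the odd part. -/
theorem two_mul_finrank_even {v : M} (hv : Q v ≠ 0) :
    2 * finrank K (even Q) = 2 ^ finrank K M := by
  have hinj : Function.Injective (mulRight K (ι Q v)) := fun x y h => by
    have h' : x * ι Q v * ι Q v = y * ι Q v * ι Q v := congrArg (· * ι Q v) h
    simp only [mul_assoc, ι_sq_scalar, ← Algebra.commutes, ← Algebra.smul_def] at h'
    exact smul_right_injective _ hv h'
  have hle (i : ZMod 2) : finrank K (evenOdd Q i) ≤ finrank K (evenOdd Q (i + 1)) := by
    rw [(Submodule.equivMapOfInjective _ hinj (evenOdd Q i)).finrank_eq]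
    apply Submodule.finrank_mono
    rintro _ ⟨x, hx, rfl⟩
    exact SetLike.GradedMul.mul_mem hx (ι_mem_evenOdd_one Q v)
  have h := Submodule.finrank_add_eq_of_isCompl (evenOdd_isCompl Q)
  have h₀ : finrank K (evenOdd Q 0) ≤ finrank K (evenOdd Q 1) := hle 0
  have h₁ : finrank K (evenOdd Q 1) ≤ finrank K (evenOdd Q 0) := hle 1
  have he : finrank K (even Q) = finrank K (evenOdd Q 0) := by
    rw [← even_toSubmodule]; rfl
  rw [finrank_eq] at h
  omega

end Finrank

end CliffordAlgebra

section HyperbolicPair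

variable {A : Type*} [Ring A] {a b g : A}

theorem mul_mul_comm_of_anticomm (hag : a * g + g * a = 0) (hbg : b * g + g * b = 0) :
    a * b * g = g * (a * b) := by
  linear_combination (norm := noncomm_ring) a * hbg - hag * b

theorem hyperbolicPair_idempotent (hb : b * b = 0) (hab : a * b + b * a = 1) :
    a * b * (a * b) = a * b := by
  linear_combination (norm := noncomm_ring) a * hab * b - a * a * hb

theorem hyperbolicPair_conj (hb : b * b = 0) (hab : a * b + b * a = 1)
    (hag : a * g + g * a = 0) (hbg : b * g + g * b = 0) :
    (a + b) * g * (a * b) = (1 - a * b) * ((a + b) * g) := by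
  have hg := mul_mul_comm_of_anticomm hag hbg
  linear_combination (norm := noncomm_ring)
    -((a + b) * hg) + (a * hab + b * hab - hb * a + a * hb) * g

theorem hyperbolicPair_sq (ha : a * a = 0) (hb : b * b = 0) (hab : a * b + b * a = 1)
    (hag : a * g + g * a = 0) (hbg : b * g + g * b = 0) :
    (a + b) * g * ((a + b) * g) = -(g * g) := by
  linear_combination (norm := noncomm_ring)
    (a + b) * (hag + hbg) * g - (ha + hb + hab) * g * g

end HyperbolicPair


namespace CliffordAlgebra

/-- Let `x, y` and `z, t` be two orthogonal hyperbolic pairs, both orthogonal to an anisotropic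
vector `v`. Then the left ideal of the even Clifford algebra generated by the product of the two
commuting idempotents `x * y` and `z * t` has a quarter of the full dimension. -/
theorem finrank_even_eq_four_mul {K M : Type*} [Field K] [Invertible (2 : K)] [AddCommGroup M]
    [Module K M] [FiniteDimensional K M] (Q : QuadraticForm K M) {x y z t v : M}
    (hx : Q x = 0) (hy : Q y = 0) (hz : Q z = 0) (ht : Q t = 0) (hv : Q v ≠ 0)
    (hxy : QuadraticMap.polar Q x y = 1) (hzt : QuadraticMap.polar Q z t = 1)
    (hxz : QuadraticMap.polar Q x z = 0) (hxt : QuadraticMap.polar Q x t = 0)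
    (hyz : QuadraticMap.polar Q y z = 0) (hyt : QuadraticMap.polar Q y t = 0)
    (hxv : QuadraticMap.polar Q x v = 0) (hyv : QuadraticMap.polar Q y v = 0)
    (hzv : QuadraticMap.polar Q z v = 0) (htv : QuadraticMap.polar Q t v = 0)
    (hmem : ι Q x * ι Q y * (ι Q z * ι Q t) ∈ even Q) :
    finrank K (even Q) = 4 * finrank K
      (range (mulRight K (⟨ι Q x * ι Q y * (ι Q z * ι Q t), hmem⟩ : even Q))) := by
  have sq {p : M} (hp : Q p = 0) : ι Q p * ι Q p = 0 := by rw [ι_sq_scalar, hp, map_zero]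
  have pair {p q : M} (h : QuadraticMap.polar Q p q = 1) : ι Q p * ι Q q + ι Q q * ι Q p = 1 := by
    rw [ι_mul_ι_add_swap, h, map_one]
  have anti {p q : M} (h : QuadraticMap.polar Q p q = 0) : ι Q p * ι Q q + ι Q q * ι Q p = 0 := by
    rw [ι_mul_ι_add_swap, h, map_zero]
  have anti' {p q : M} (h : QuadraticMap.polar Q p q = 0) : ι Q q * ι Q p + ι Q p * ι Q q = 0 := by
    rw [add_comm, anti h]
  let e : even Q := ⟨ι Q x * ι Q y, ι_mul_ι_mem_evenOdd_zero Q x y⟩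
  let e' : even Q := ⟨ι Q z * ι Q t, ι_mul_ι_mem_evenOdd_zero Q z t⟩
  let w : even Q := ⟨ι Q (x + y) * ι Q v, ι_mul_ι_mem_evenOdd_zero Q _ v⟩
  let w' : even Q := ⟨ι Q (z + t) * ι Q v, ι_mul_ι_mem_evenOdd_zero Q _ v⟩
  have isUnit_of_sq {u : even Q} (h : (u * u : CliffordAlgebra Q) = -(ι Q v * ι Q v)) :
      IsUnit u := by
    have huu : u * u = algebraMap K (even Q) (-Q v) := by
      apply Subtype.ext
      simpa [ι_sq_scalar] using h
    have : IsUnit (u * u) := by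
      rw [huu]
      exact (IsUnit.mk0 _ (neg_ne_zero.2 hv)).map _
    exact ((Commute.refl u).isUnit_mul_iff.1 this).1
  have hw : IsUnit w := isUnit_of_sq <| by
    simpa only [w, map_add] using
      hyperbolicPair_sq (sq hx) (sq hy) (pair hxy) (anti hxv) (anti hyv)
  have hw' : IsUnit w' := isUnit_of_sq <| by
    simpa only [w', map_add] using
      hyperbolicPair_sq (sq hz) (sq ht) (pair hzt) (anti hzv) (anti htv)
  have he : e * e = e := Subtype.ext <| hyperbolicPair_idempotent (sq hy) (pair hxy)
  have he' : e' * e' = e' := Subtype.ext <| hyperbolicPair_idempotent (sq ht) (pair hzt)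
  have hwe : w * e = (1 - e) * w := Subtype.ext <| by
    simpa [w, e] using hyperbolicPair_conj (sq hy) (pair hxy) (anti hxv) (anti hyv)
  have hwe' : w' * e' = (1 - e') * w' := Subtype.ext <| by
    simpa [w', e'] using hyperbolicPair_conj (sq ht) (pair hzt) (anti hzv) (anti htv)
  have hcx : ι Q z * ι Q t * ι Q x = ι Q x * (ι Q z * ι Q t) :=
    mul_mul_comm_of_anticomm (anti' hxz) (anti' hxt)
  have hcy : ι Q z * ι Q t * ι Q y = ι Q y * (ι Q z * ι Q t) :=
    mul_mul_comm_of_anticomm (anti' hyz) (anti' hyt)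
  have hcv : ι Q z * ι Q t * ι Q v = ι Q v * (ι Q z * ι Q t) :=
    mul_mul_comm_of_anticomm (anti hzv) (anti htv)
  have hee : e' * e = e * e' := Subtype.ext (Commute.mul_right hcx hcy)
  have hew : e' * w = w * e' := Subtype.ext <| by
    have : Commute (ι Q z * ι Q t) ((ι Q x + ι Q y) * ι Q v) :=
      (Commute.add_right hcx hcy).mul_right hcv
    simpa [w, e'] using this.eq
  have h₁ := finrank_range_mulRight_eq_two_mul (K := K) he' hw' hwe' (b := 1)
    (by simp) (by simp)
  have h₂ := finrank_range_mulRight_eq_two_mul (K := K) he hw hwe hee hew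
  rw [mulRight_one, range_id, finrank_top, mul_one] at h₁
  have h₃ : (⟨ι Q x * ι Q y * (ι Q z * ι Q t), hmem⟩ : even Q) = e * e' := rfl
  rw [h₃]
  omega

end CliffordAlgebra

/-- For negative rationals `l, m` and the quadratic form
`Q = Hyp ⊕ Hyp ⊕ ⟨l⟩ ⊕ ⟨m⟩` on `ℚ⁶`, the element `β = (1/4)·f₁f₂f₃f₄` lies in the even
Clifford algebra `C⁺(Q)`, and the `ℚ`-linear map `x ↦ x·β` of right multiplication by `β`
on `C⁺(Q)` has kernel of dimension `24` over `ℚ` and range of dimension `8` over `ℚ`. -/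
theorem clifford_mulRight_beta_rank
    (l m : ℚ) (hl : l < 0) (hm : m < 0)
    (Q : QuadraticForm ℚ (Fin 6 → ℚ))
    (hQ : ∀ x : Fin 6 → ℚ,
      Q x = 2 * x 0 * x 1 + 2 * x 2 * x 3 + l * x 4 ^ 2 + m * x 5 ^ 2)
    (β : CliffordAlgebra Q)
    (hβ : β = ((1 : ℚ)/4) •
      (CliffordAlgebra.ι Q (Pi.single (0 : Fin 6) (1 : ℚ)) *
       CliffordAlgebra.ι Q (Pi.single (1 : Fin 6) (1 : ℚ)) *
       CliffordAlgebra.ι Q (Pi.single (2 : Fin 6) (1 : ℚ)) *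
       CliffordAlgebra.ι Q (Pi.single (3 : Fin 6) (1 : ℚ)))) :
    ∃ hmem : β ∈ CliffordAlgebra.even Q,
      Module.finrank ℚ
        (LinearMap.ker (LinearMap.mulRight ℚ (⟨β, hmem⟩ : CliffordAlgebra.even Q))) = 24 ∧
      Module.finrank ℚ
        (LinearMap.range (LinearMap.mulRight ℚ (⟨β, hmem⟩ : CliffordAlgebra.even Q))) = 8 := by
  have hQ' (p q : Fin 6 → ℚ) : QuadraticMap.polar Q p q = 2 * (p 0 * q 1 + q 0 * p 1) +
      2 * (p 2 * q 3 + q 2 * p 3) + 2 * l * (p 4 * q 4) + 2 * m * (p 5 * q 5) := by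
    simp only [QuadraticMap.polar, hQ, Pi.add_apply]
    ring
  have hβ' : β = CliffordAlgebra.ι Q (Pi.single 0 1) *
      CliffordAlgebra.ι Q ((1 / 2 : ℚ) • Pi.single 1 1) *
      (CliffordAlgebra.ι Q (Pi.single 2 1) *
      CliffordAlgebra.ι Q ((1 / 2 : ℚ) • Pi.single 3 1)) := by
    rw [hβ]
    simp only [map_smul, mul_smul_comm, smul_mul_assoc, smul_smul, mul_assoc]
    norm_num
  have hmem : β ∈ CliffordAlgebra.even Q := by
    rw [hβ']
    exact mul_mem (CliffordAlgebra.ι_mul_ι_mem_evenOdd_zero Q _ _)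
      (CliffordAlgebra.ι_mul_ι_mem_evenOdd_zero Q _ _)
  have hv : Q (Pi.single 4 1) ≠ 0 := by
    simpa [hQ] using hl.ne
  have heven := CliffordAlgebra.two_mul_finrank_even Q hv
  rw [finrank_fin_fun] at heven
  subst hβ'
  have hrange := CliffordAlgebra.finrank_even_eq_four_mul Q (x := Pi.single 0 1)
    (y := (1 / 2 : ℚ) • Pi.single 1 1) (z := Pi.single 2 1)
    (t := (1 / 2 : ℚ) • Pi.single 3 1) (v := Pi.single 4 1)
    (by simp [hQ]) (by simp [hQ]) (by simp [hQ]) (by simp [hQ]) hv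
    (by simp [hQ']) (by simp [hQ']) (by simp [hQ']) (by simp [hQ']) (by simp [hQ'])
    (by simp [hQ']) (by simp [hQ']) (by simp [hQ']) (by simp [hQ']) (by simp [hQ']) hmem
  have hker := finrank_range_add_finrank_ker (mulRight ℚ
    (⟨_, hmem⟩ : CliffordAlgebra.even Q))
  exact ⟨hmem, by omega, by omega⟩
end
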